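/- Write H̄(p) for the common deterministic value H̄₊(p) = H̄₋(p). Then for every p ∈ ℝ^d: (i) almost surely in ω, H̄(p) = inf_{w ∈ 𝓢} esssup_{y ∈ ℝ^d} H(p + Dw(y), y, ω), i.e. Ĥ(p) = H̄(p); and (ii) there exists a jointly measurable w : ℝ^d × Ω → ℝ, Lipschitz in its first variable with a constant independent of ω, with stationary increments (w(x, τ_z ω) − w(y, τ_z ω) = w(x+z, ω) − w(y+z, ω)) and mean-zero increments (E[w(x,·) − w(0,·)] = 0 for every x), such that almost surely in ω: H(p + Dw(y,ω), y, ω) ≤ H̄(p) for almost every y ∈ ℝ^d, and lim_{|y|→∞} w(y,ω)/|y| = 0 (i.e. w(·,ω) ∈ 𝓢). -/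

import Mathlib

open MeasureTheory Filter Topology Bornology
open scoped RealInnerProductSpace NNReal

noncomputable section

/-- Euclidean space ℝ^d. -/
abbrev Ed (d : ℕ) := EuclideanSpace ℝ (Fin d)

/-- The set 𝓛 of globally Lipschitz real-valued functions on ℝ^d. -/
def LipFuns (d : ℕ) : Set (Ed d → ℝ) := {w | ∃ C : ℝ≥0, LipschitzWith C w}

/-- SL⁺ : Lipschitz functions sublinear from below, i.e. liminf_{|y|→∞} w(y)/|y| ≥ 0. -/
def SLplus (d : ℕ) : Set (Ed d → ℝ) :=
  {w | w ∈ LipFuns d ∧ ∀ ε : ℝ, 0 < ε → ∃ R : ℝ, ∀ y : Ed d, R ≤ ‖y‖ → -ε ≤ w y / ‖y‖}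

/-- SL⁻ : Lipschitz functions sublinear from above, i.e. limsup_{|y|→∞} w(y)/|y| ≤ 0. -/
def SLminus (d : ℕ) : Set (Ed d → ℝ) :=
  {w | w ∈ LipFuns d ∧ ∀ ε : ℝ, 0 < ε → ∃ R : ℝ, ∀ y : Ed d, R ≤ ‖y‖ → w y / ‖y‖ ≤ ε}

/-- 𝓢 : Lipschitz functions strictly sublinear at infinity. -/
def Scal (d : ℕ) : Set (Ed d → ℝ) := SLplus d ∩ SLminus d

/-- H̄₊(p) = inf_{w ∈ SL⁺} esssup_y H(p + Dw(y), y). -/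
def HbarPlus (d : ℕ) (H : Ed d → Ed d → ℝ) (p : Ed d) : ℝ :=
  sInf {t | ∃ w ∈ SLplus d, t = essSup (fun y => H (p + gradient w y) y) volume}

/-- H̄₋(p) = inf_{w ∈ SL⁻} esssup_y H(p + Dw(y), y). -/
def HbarMinus (d : ℕ) (H : Ed d → Ed d → ℝ) (p : Ed d) : ℝ :=
  sInf {t | ∃ w ∈ SLminus d, t = essSup (fun y => H (p + gradient w y) y) volume}

/-- Ĥ(p) = inf_{w ∈ 𝓢} esssup_y H(p + Dw(y), y). -/
def Hhat (d : ℕ) (H : Ed d → Ed d → ℝ) (p : Ed d) : ℝ :=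
  sInf {t | ∃ w ∈ Scal d, t = essSup (fun y => H (p + gradient w y) y) volume}

/-- H̄* = inf_{w ∈ 𝓛} esssup_y H(Dw(y), y). -/
def Hstar (d : ℕ) (H : Ed d → Ed d → ℝ) : ℝ :=
  sInf {t | ∃ w ∈ LipFuns d, t = essSup (fun y => H (gradient w y) y) volume}

/-- m_μ(y,x) = sup { w(y) − w(x) : w ∈ 𝓛, H(Dw,z) ≤ μ a.e. }. -/
def mMu (d : ℕ) (H : Ed d → Ed d → ℝ) (μ : ℝ) (y x : Ed d) : ℝ :=
  sSup {t | ∃ w ∈ LipFuns d, (∀ᵐ z ∂volume, H (gradient w z) z ≤ μ) ∧ t = w y - w x}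

/-- Viscosity subsolution of F(Du, y) ≤ μ in U. -/
def ViscSub (d : ℕ) (F : Ed d → Ed d → ℝ) (μ : ℝ) (U : Set (Ed d)) (u : Ed d → ℝ) : Prop :=
  ∀ (φ : Ed d → ℝ) (x₀ : Ed d), x₀ ∈ U → ContDiffAt ℝ 1 φ x₀ →
    IsLocalMaxOn (fun y => u y - φ y) U x₀ → F (gradient φ x₀) x₀ ≤ μ

/-- Viscosity supersolution of F(Dv, y) ≥ μ in U. -/
def ViscSuper (d : ℕ) (F : Ed d → Ed d → ℝ) (μ : ℝ) (U : Set (Ed d)) (v : Ed d → ℝ) : Prop :=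
  ∀ (φ : Ed d → ℝ) (x₀ : Ed d), x₀ ∈ U → ContDiffAt ℝ 1 φ x₀ →
    IsLocalMinOn (fun y => v y - φ y) U x₀ → μ ≤ F (gradient φ x₀) x₀ 

/-- ω-dependent H̄₊. -/
def HbarPlusOm (d : ℕ) {Ω : Type*} (H : Ed d → Ed d → Ω → ℝ) (p : Ed d) (ω : Ω) : ℝ :=
  sInf {t | ∃ w ∈ SLplus d, t = essSup (fun y => H (p + gradient w y) y ω) volume}

/-- ω-dependent H̄₋. -/
def HbarMinusOm (d : ℕ) {Ω : Type*} (H : Ed d → Ed d → Ω → ℝ) (p : Ed d) (ω : Ω) : ℝ :=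
  sInf {t | ∃ w ∈ SLminus d, t = essSup (fun y => H (p + gradient w y) y ω) volume}

/-- ω-dependent Ĥ. -/
def HhatOm (d : ℕ) {Ω : Type*} (H : Ed d → Ed d → Ω → ℝ) (p : Ed d) (ω : Ω) : ℝ :=
  sInf {t | ∃ w ∈ Scal d, t = essSup (fun y => H (p + gradient w y) y ω) volume}

/-- ω-dependent H̄*. -/
def HstarOm (d : ℕ) {Ω : Type*} (H : Ed d → Ed d → Ω → ℝ) (ω : Ω) : ℝ :=
  sInf {t | ∃ w ∈ LipFuns d, t = essSup (fun y => H (gradient w y) y ω) volume}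

/-- ω-dependent metric problem solution m_μ(y,x,ω). -/
def mMuOm (d : ℕ) {Ω : Type*} (H : Ed d → Ed d → Ω → ℝ) (μ : ℝ) (y x : Ed d) (ω : Ω) : ℝ :=
  sSup {t | ∃ w ∈ LipFuns d, (∀ᵐ z ∂volume, H (gradient w z) z ω ≤ μ) ∧ t = w y - w x}


/-! ### A Hilbert space lemma -/

lemma hilbert_cauchy {E : Type*} [NormedAddCommGroup E] [InnerProductSpace ℝ E]
    (S : ℕ → Set E) (hanti : Antitone S) (hconv : ∀ j, Convex ℝ (S j))
    (hne : ∀ j, (S j).Nonempty) (B : ℝ) (hB : ∀ f ∈ S 0, ‖f‖ ≤ B) :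
    ∃ f : ℕ → E, (∀ j, f j ∈ S j) ∧ CauchySeq f := by
  set r : ℕ → ℝ := fun j => sInf ((fun f => ‖f‖ ^ 2) '' S j) with hr
  have hbdd : ∀ j, BddBelow ((fun f : E => ‖f‖ ^ 2) '' S j) := fun j =>
    ⟨0, by rintro _ ⟨f, -, rfl⟩; positivity⟩
  have hmono : Monotone r := fun i j hij =>
    csInf_le_csInf (hbdd i) ((hne j).image _) (Set.image_mono (hanti hij))
  have hle : ∀ j, ∀ f ∈ S j, r j ≤ ‖f‖ ^ 2 := fun j f hf => csInf_le (hbdd j) ⟨f, hf, rfl⟩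
  have hub : ∀ j, r j ≤ B ^ 2 := by
    intro j
    obtain ⟨f, hf⟩ := hne j
    have h0 := hB f (hanti (Nat.zero_le j) hf)
    exact (hle j f hf).trans (by gcongr)
  have hbr : BddAbove (Set.range r) := ⟨B ^ 2, by rintro _ ⟨j, rfl⟩; exact hub j⟩
  have hlim := tendsto_atTop_ciSup hmono hbr
  set R := ⨆ j, r j
  have hrR : ∀ j, r j ≤ R := fun j => le_ciSup hbr j
  have hex : ∀ j, ∃ f ∈ S j, ‖f‖ ^ 2 < r j + 1 / ((j : ℝ) + 1) := by
    intro j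
    have : r j < r j + 1 / ((j : ℝ) + 1) := by
      have : (0 : ℝ) < 1 / ((j : ℝ) + 1) := by positivity
      linarith
    obtain ⟨_, ⟨f, hf, rfl⟩, h⟩ := exists_lt_of_csInf_lt ((hne j).image _) this
    exact ⟨f, hf, h⟩
  choose f hf hf2 using hex
  refine ⟨f, hf, ?_⟩
  refine cauchySeq_of_le_tendsto_0
    (fun N : ℕ => Real.sqrt (4 * (R - r N) + 4 * (1 / ((N : ℝ) + 1)))) ?_ ?_
  · intro n m N hn hm
    rw [dist_eq_norm]
    apply Real.le_sqrt_of_sq_le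
    have hp := parallelogram_law_with_norm ℝ (f n) (f m)
    have hmid : (1 / 2 : ℝ) • f n + (1 / 2 : ℝ) • f m ∈ S N :=
      hconv N (hanti hn (hf n)) (hanti hm (hf m)) (by norm_num) (by norm_num) (by norm_num)
    have h1 := hle N _ hmid
    rw [← smul_add, norm_smul] at h1
    have h2 : ‖(1 / 2 : ℝ)‖ = 1 / 2 := by norm_num
    rw [h2] at h1
    have h3 := hf2 n
    have h4 := hf2 m
    have h5 : 1 / ((n : ℝ) + 1) ≤ 1 / ((N : ℝ) + 1) := by
      have : (N : ℝ) ≤ n := by exact_mod_cast hn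
      gcongr
    have h6 : 1 / ((m : ℝ) + 1) ≤ 1 / ((N : ℝ) + 1) := by
      have : (N : ℝ) ≤ m := by exact_mod_cast hm
      gcongr
    have h7 := hrR n
    have h8 := hrR m
    nlinarith
  · have h1 : Tendsto (fun N : ℕ => 4 * (R - r N) + 4 * (1 / ((N : ℝ) + 1))) atTop
        (𝓝 (4 * (R - R) + 4 * 0)) :=
      ((tendsto_const_nhds.sub hlim).const_mul 4).add
        (tendsto_one_div_add_atTop_nhds_zero_nat.const_mul 4)
    have h2 := (Real.continuous_sqrt.tendsto _).comp h1
    simpa [Function.comp_def] using h2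

/-! ### Processes -/

/-- Normalised Lipschitz processes. -/
structure PreProc {d : ℕ} {Ω : Type*} [MeasurableSpace Ω] (C : ℝ≥0)
    (w : Ed d → Ω → ℝ) : Prop where
  meas : ∀ x, Measurable (w x)
  lip : ∀ ω, LipschitzWith C (fun x => w x ω)
  zero : ∀ ω, w 0 ω = 0

/-- Normalised Lipschitz processes with stationary increments. -/
structure StatProc {d : ℕ} {Ω : Type*} [MeasurableSpace Ω] (τ : Ed d → Ω → Ω) (C : ℝ≥0)
    (w : Ed d → Ω → ℝ) : Prop extends PreProc C w where
  stat : ∀ x z ω, w x (τ z ω) = w (x + z) ω - w z ω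

/-- Almost sure domination of increments by a cost. -/
def SubC {d : ℕ} {Ω : Type*} [MeasurableSpace Ω] (P : Measure Ω) (c : Ed d → Ed d → Ω → ℝ)
    (w : Ed d → Ω → ℝ) : Prop := ∀ᵐ ω ∂P, ∀ a b, w b ω - w a ω ≤ c a b ω

lemma lip_iff' {d : ℕ} {C : ℝ≥0} {f : Ed d → ℝ} :
    LipschitzWith C f ↔ ∀ x y, |f x - f y| ≤ C * ‖x - y‖ := by
  rw [lipschitzWith_iff_dist_le_mul]
  simp only [dist_eq_norm, Real.norm_eq_abs]

section
variable {d : ℕ} {Ω : Type*} [MeasurableSpace Ω]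

lemma PreProc.abs_sub_le {C : ℝ≥0} {w : Ed d → Ω → ℝ} (h : PreProc C w) (x y : Ed d) (ω : Ω) :
    |w x ω - w y ω| ≤ C * ‖x - y‖ := lip_iff'.1 (h.lip ω) x y

lemma PreProc.abs_le {C : ℝ≥0} {w : Ed d → Ω → ℝ} (h : PreProc C w) (x : Ed d) (ω : Ω) :
    |w x ω| ≤ C * ‖x‖ := by
  have := h.abs_sub_le x 0 ω
  simpa [h.zero] using this

lemma convex_preProc (C : ℝ≥0) : Convex ℝ {w : Ed d → Ω → ℝ | PreProc C w} := by
  intro u hu v hv a b ha hb hab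
  refine ⟨fun x => ?_, fun ω => ?_, fun ω => ?_⟩
  · exact ((hu.meas x).const_mul a).add ((hv.meas x).const_mul b)
  · rw [lip_iff']
    intro x y
    have h1 := hu.abs_sub_le x y ω
    have h2 := hv.abs_sub_le x y ω
    simp only [Pi.add_apply, Pi.smul_apply, smul_eq_mul]
    calc |a * u x ω + b * v x ω - (a * u y ω + b * v y ω)|
        = |a * (u x ω - u y ω) + b * (v x ω - v y ω)| := by ring_nf
      _ ≤ a * |u x ω - u y ω| + b * |v x ω - v y ω| := by
          refine (abs_add_le _ _).trans ?_
          rw [abs_mul, abs_mul, abs_of_nonneg ha, abs_of_nonneg hb]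
      _ ≤ a * (C * ‖x - y‖) + b * (C * ‖x - y‖) := by gcongr
      _ = C * ‖x - y‖ := by rw [← add_mul, hab, one_mul]
  · simp [hu.zero, hv.zero]

lemma PreProc.integrable {C : ℝ≥0} {w : Ed d → Ω → ℝ} (h : PreProc C w) (P : Measure Ω)
    [IsProbabilityMeasure P] (x : Ed d) : Integrable (w x) P :=
  Integrable.of_bound (h.meas x).aestronglyMeasurable (C * ‖x‖)
    (Eventually.of_forall fun ω => by rw [Real.norm_eq_abs]; exact h.abs_le x ω)

lemma convex_subC (P : Measure Ω) (c : Ed d → Ed d → Ω → ℝ) :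
    Convex ℝ {w : Ed d → Ω → ℝ | SubC P c w} := by
  intro u hu v hv a b ha hb hab
  simp only [Set.mem_ofPred_eq, SubC] at *
  filter_upwards [hu, hv] with ω h1 h2 x y
  simp only [Pi.add_apply, Pi.smul_apply, smul_eq_mul]
  have e1 := mul_le_mul_of_nonneg_left (h1 x y) ha
  have e2 := mul_le_mul_of_nonneg_left (h2 x y) hb
  have : c x y ω = a * c x y ω + b * c x y ω := by rw [← add_mul, hab, one_mul]
  linarith

end

section
variable {d : ℕ} {Ω : Type*} [MeasurableSpace Ω]

lemma convex_tail_preProc {C : ℝ≥0} {w : ℕ → Ed d → Ω → ℝ} (hw : ∀ k, PreProc C (w k))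
    {j : ℕ} {v : Ed d → Ω → ℝ} (hv : v ∈ convexHull ℝ (w '' Set.Ici j)) : PreProc C v := by
  refine convexHull_min ?_ (convex_preProc C) hv
  rintro _ ⟨k, -, rfl⟩
  exact hw k

lemma extraction (P : Measure Ω) [IsProbabilityMeasure P] {C : ℝ≥0} {w : ℕ → Ed d → Ω → ℝ}
    (hw : ∀ k, PreProc C (w k)) (xs : ℕ → Ed d) :
    ∃ u : ℕ → Ed d → Ω → ℝ, (∀ n, u n ∈ convexHull ℝ (w '' Set.Ici n)) ∧
      ∀ᵐ ω ∂P, ∀ i, ∃ l, Tendsto (fun n => u n (xs i) ω) atTop (𝓝 l) := by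
  set V : ℕ → Set (Ed d → Ω → ℝ) := fun j => convexHull ℝ (w '' Set.Ici j) with hVdef
  have hVanti : Antitone V := fun i j hij =>
    convexHull_mono (Set.image_mono (Set.Ici_subset_Ici.2 hij))
  have hV : ∀ j, ∀ v ∈ V j, PreProc C v := fun j v hv => convex_tail_preProc hw hv
  let ν : Measure ℕ := (Measure.count : Measure ℕ).toFinite
  have hνae : ∀ p : ℕ → Prop, (∀ᵐ i ∂ν, p i) → ∀ i, p i := by
    intro p hp
    have : ∀ᵐ i ∂(Measure.count : Measure ℕ), p i := by
      have h : ae ν = ae (Measure.count : Measure ℕ) := ae_toFinite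
      rw [← h]; exact hp
    exact Measure.ae_count_iff.1 this
  let G : (Ed d → Ω → ℝ) → Ω × ℕ → ℝ := fun v q => v (xs q.2) q.1 / (1 + ‖xs q.2‖)
  have hGm : ∀ v, PreProc C v → Measurable (G v) := by
    intro v hv
    refine measurable_from_prod_countable_left fun i => ?_
    exact (hv.meas (xs i)).div_const (1 + ‖xs i‖)
  have hGb : ∀ v, PreProc C v → ∀ q, ‖G v q‖ ≤ C := by
    intro v hv q
    have h1 := hv.abs_le (xs q.2) q.1
    have h2 : (0 : ℝ) < 1 + ‖xs q.2‖ := by positivity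
    simp only [G, norm_div, Real.norm_eq_abs]
    rw [abs_of_pos h2, div_le_iff₀ h2]
    refine h1.trans ?_
    have : (0 : ℝ) ≤ C := C.2
    nlinarith
  have hGL : ∀ v, PreProc C v → MemLp (G v) 2 (P.prod ν) := fun v hv =>
    MemLp.of_bound (hGm v hv).aestronglyMeasurable C (Eventually.of_forall (hGb v hv))
  let S : ℕ → Set (Lp ℝ 2 (P.prod ν)) := fun j => {f | ∃ v ∈ V j, f =ᵐ[P.prod ν] G v}
  have hS := hilbert_cauchy S
    (fun i j hij f hf => by
      obtain ⟨v, hv, h⟩ := hf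
      exact ⟨v, hVanti hij hv, h⟩)
    (by
      rintro j f ⟨v, hv, hfv⟩ g ⟨v', hv', hgv⟩ a b ha hb hab
      refine ⟨a • v + b • v', convex_convexHull ℝ _ hv hv' ha hb hab, ?_⟩
      filter_upwards [hfv, hgv, Lp.coeFn_add (a • f) (b • g), Lp.coeFn_smul a f,
        Lp.coeFn_smul b g] with q h1 h2 h3 h4 h5
      rw [h3, Pi.add_apply, h4, h5, Pi.smul_apply, Pi.smul_apply, h1, h2]
      simp only [G, Pi.add_apply, Pi.smul_apply, smul_eq_mul]
      ring)
    (by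
      intro j
      have hj : w j ∈ V j := subset_convexHull ℝ _ ⟨j, Set.self_mem_Ici, rfl⟩
      exact ⟨(hGL _ (hV j _ hj)).toLp, w j, hj, MemLp.coeFn_toLp _⟩)
    _
    (by
      rintro f ⟨v, hv, hfv⟩
      refine Lp.norm_le_of_ae_bound (C := (C : ℝ)) C.2 ?_
      filter_upwards [hfv] with q hq
      rw [hq]
      exact hGb v (hV 0 v hv) q)
  obtain ⟨f, hfS, hfc⟩ := hS
  choose v hv hfv using hfS
  obtain ⟨g, hg⟩ := cauchySeq_tendsto_of_complete hfc
  obtain ⟨ns, hns, hae⟩ := (tendstoInMeasure_of_tendsto_Lp hg).exists_seq_tendsto_ae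
  refine ⟨fun n => v (ns n), fun n => hVanti (hns.id_le n) (hv (ns n)), ?_⟩
  have hall : ∀ᵐ q ∂(P.prod ν), Tendsto (fun n => G (v (ns n)) q) atTop (𝓝 (g q)) := by
    have h2 : ∀ᵐ q ∂(P.prod ν), ∀ n, f n q = G (v n) q := ae_all_iff.2 hfv
    filter_upwards [hae, h2] with q h1 h2
    simpa [h2] using h1
  filter_upwards [Measure.ae_ae_of_ae_prod hall] with ω hω i
  have h1 := hνae _ hω i
  refine ⟨g (ω, i) * (1 + ‖xs i‖), ?_⟩
  have h2 := h1.mul_const (1 + ‖xs i‖)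
  refine h2.congr fun n => ?_
  have : (1 + ‖xs i‖ : ℝ) ≠ 0 := by positivity
  simp only [G]
  field_simp

lemma tendsto_of_dense {C : ℝ≥0} {u : ℕ → Ed d → Ω → ℝ} (hu : ∀ n, PreProc C (u n))
    {xs : ℕ → Ed d} (hxs : DenseRange xs) {ω : Ω}
    (h : ∀ i, ∃ l, Tendsto (fun n => u n (xs i) ω) atTop (𝓝 l)) (x : Ed d) :
    ∃ l, Tendsto (fun n => u n x ω) atTop (𝓝 l) := by
  apply cauchySeq_tendsto_of_complete
  rw [Metric.cauchySeq_iff]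
  intro ε hε
  obtain ⟨i, hi⟩ := hxs.exists_dist_lt x (show 0 < ε / (3 * (C + 1)) by positivity)
  obtain ⟨l, hl⟩ := h i
  obtain ⟨N, hN⟩ := Metric.cauchySeq_iff.1 hl.cauchySeq (ε / 3) (by positivity)
  refine ⟨N, fun m hm n hn => ?_⟩
  have h1 := hN m hm n hn
  have h2 := (hu m).abs_sub_le x (xs i) ω
  have h3 := (hu n).abs_sub_le x (xs i) ω
  rw [dist_eq_norm] at hi
  have h4 : (C : ℝ) * ‖x - xs i‖ < ε / 3 := by
    have h5 : ((C : ℝ) + 1) * ‖x - xs i‖ < (C + 1) * (ε / (3 * (C + 1))) := by gcongr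
    have h6 : ((C : ℝ) + 1) * (ε / (3 * (C + 1))) = ε / 3 := by field_simp
    nlinarith [norm_nonneg (x - xs i)]
  rw [Real.dist_eq] at *
  rw [abs_le] at h2 h3
  rw [abs_lt] at *
  constructor <;> linarith

lemma limit_lemma (P : Measure Ω) [IsProbabilityMeasure P] {τ : Ed d → Ω → Ω}
    (hτgrp : ∀ x y : Ed d, τ (x + y) = τ x ∘ τ y) (hτzero : τ 0 = id)
    {C : ℝ≥0} {w : ℕ → Ed d → Ω → ℝ} (hw : ∀ k, PreProc C (w k))
    (has : ∀ x z : Ed d, ∀ ε : ℝ, 0 < ε → ∃ N : ℕ, ∀ k ≥ N, ∀ ω,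
      |w k x (τ z ω) - (w k (x + z) ω - w k z ω)| ≤ ε) :
    ∃ W : Ed d → Ω → ℝ, StatProc τ C W ∧
      (∀ c, (∀ᶠ k in atTop, SubC P c (w k)) → SubC P c W) ∧
      (∀ x r, (∀ᶠ k in atTop, ∫ ω, w k x ω ∂P ≤ r) → ∫ ω, W x ω ∂P ≤ r) ∧
      (∀ x r, (∀ᶠ k in atTop, r ≤ ∫ ω, w k x ω ∂P) → r ≤ ∫ ω, W x ω ∂P) := by
  classical
  set xs : ℕ → Ed d := TopologicalSpace.denseSeq (Ed d)
  have hxs : DenseRange xs := TopologicalSpace.denseRange_denseSeq _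
  obtain ⟨u, huV, hae⟩ := extraction P hw xs
  have hu : ∀ n, PreProc C (u n) := fun n => convex_tail_preProc hw (huV n)
  have hus : ∀ x z : Ed d, ∀ ε : ℝ, 0 < ε → ∃ N : ℕ, ∀ k ≥ N, ∀ ω,
      |u k x (τ z ω) - (u k (x + z) ω - u k z ω)| ≤ ε := by
    intro x z ε hε
    obtain ⟨N, hN⟩ := has x z ε hε
    refine ⟨N, fun k hk => ?_⟩
    have hsub : convexHull ℝ (w '' Set.Ici k) ⊆ {v : Ed d → Ω → ℝ | ∀ ω,
        |v x (τ z ω) - (v (x + z) ω - v z ω)| ≤ ε} := by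
      refine convexHull_min ?_ ?_
      · rintro _ ⟨j, hj, rfl⟩
        exact hN j (le_trans hk hj)
      · intro f hf g hg a b ha hb hab ω
        have e1 := mul_le_mul_of_nonneg_left (hf ω) ha
        have e2 := mul_le_mul_of_nonneg_left (hg ω) hb
        simp only [Pi.add_apply, Pi.smul_apply, smul_eq_mul]
        calc _ = |a * (f x (τ z ω) - (f (x + z) ω - f z ω)) +
              b * (g x (τ z ω) - (g (x + z) ω - g z ω))| := by ring_nf
          _ ≤ a * |f x (τ z ω) - (f (x + z) ω - f z ω)| +
              b * |g x (τ z ω) - (g (x + z) ω - g z ω)| := by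
              refine (abs_add_le _ _).trans ?_
              rw [abs_mul, abs_mul, abs_of_nonneg ha, abs_of_nonneg hb]
          _ ≤ a * ε + b * ε := add_le_add e1 e2
          _ = ε := by rw [← add_mul, hab, one_mul]
    exact hsub (huV k)
  have hus0 : ∀ x z : Ed d, ∀ ω,
      Tendsto (fun n => u n x (τ z ω) - (u n (x + z) ω - u n z ω)) atTop (𝓝 0) := by
    intro x z ω
    rw [Metric.tendsto_atTop]
    intro ε hε
    obtain ⟨N, hN⟩ := hus x z (ε / 2) (by positivity)
    refine ⟨N, fun k hk => ?_⟩
    rw [Real.dist_eq, sub_zero]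
    linarith [hN k hk ω]
  let A : Set Ω := {ω | ∀ i, ∃ l, Tendsto (fun n => u n (xs i) ω) atTop (𝓝 l)}
  have hAm : MeasurableSet A := by
    have : A = ⋂ i, {ω | ∃ l, Tendsto (fun n => u n (xs i) ω) atTop (𝓝 l)} := by
      ext ω; simp [A]
    rw [this]
    exact MeasurableSet.iInter fun i => measurableSet_exists_tendsto fun n => (hu n).meas (xs i)
  have hAall : ∀ ω, ω ∈ A → ∀ x, ∃ l, Tendsto (fun n => u n x ω) atTop (𝓝 l) :=
    fun ω hω x => tendsto_of_dense hu hxs hω x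
  have hAst : ∀ ω z, ω ∈ A → τ z ω ∈ A := by
    intro ω z hω i
    obtain ⟨l, hl⟩ := hAall ω hω (xs i + z)
    obtain ⟨l', hl'⟩ := hAall ω hω z
    refine ⟨0 + (l - l'), ?_⟩
    refine ((hus0 (xs i) z ω).add (hl.sub hl')).congr fun n => by ring
  have hAst' : ∀ ω z, τ z ω ∈ A → ω ∈ A := by
    intro ω z hω
    have := hAst _ (-z) hω
    have h2 : τ (-z) (τ z ω) = ω := by
      have := congrFun (hτgrp (-z) z) ω
      simp only [neg_add_cancel, hτzero, id, Function.comp] at this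
      exact this.symm
    rwa [h2] at this
  let W : Ed d → Ω → ℝ := fun x ω =>
    if h : ω ∈ A then Classical.choose (hAall ω h x) else 0
  have hWA : ∀ ω, ω ∈ A → ∀ x, Tendsto (fun n => u n x ω) atTop (𝓝 (W x ω)) := by
    intro ω h x
    simp only [W, h, dif_pos]
    exact Classical.choose_spec (hAall ω h x)
  have hWn : ∀ ω, ω ∉ A → ∀ x, W x ω = 0 := fun ω h x => by simp only [W, h, dif_neg, not_false_eq_true]
  have hPA : ∀ᵐ ω ∂P, ω ∈ A := hae
  have hintW : ∀ x, Tendsto (fun n => ∫ ω, u n x ω ∂P) atTop (𝓝 (∫ ω, W x ω ∂P)) := by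
    intro x
    refine tendsto_integral_of_dominated_convergence (fun _ => C * ‖x‖)
      (fun n => ((hu n).meas x).aestronglyMeasurable) (integrable_const _) ?_ ?_
    · exact fun n => Eventually.of_forall fun ω => by
        rw [Real.norm_eq_abs]; exact (hu n).abs_le x ω
    · filter_upwards [hPA] with ω h using hWA ω h x
  have hconvint : ∀ x, ∀ (s : Set ℝ), Convex ℝ s →
      Convex ℝ {v : Ed d → Ω → ℝ | PreProc C v ∧ ∫ ω, v x ω ∂P ∈ s} := by
    intro x s hs f hf g hg a b ha hb hab
    refine ⟨convex_preProc C hf.1 hg.1 ha hb hab, ?_⟩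
    have : ∫ ω, (a • f + b • g) x ω ∂P = a • ∫ ω, f x ω ∂P + b • ∫ ω, g x ω ∂P := by
      simp only [Pi.add_apply, Pi.smul_apply, smul_eq_mul]
      rw [integral_add ((hf.1.integrable P x).const_mul a) ((hg.1.integrable P x).const_mul b),
        integral_const_mul, integral_const_mul]
    rw [this]
    exact hs hf.2 hg.2 ha hb hab
  have hints : ∀ x, ∀ (s : Set ℝ), Convex ℝ s → (∀ᶠ k in atTop, ∫ ω, w k x ω ∂P ∈ s) →
      ∀ᶠ k in atTop, ∫ ω, u k x ω ∂P ∈ s := by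
    intro x s hs hk
    obtain ⟨N, hN⟩ := eventually_atTop.1 hk
    filter_upwards [eventually_ge_atTop N] with k hk
    have hsub := convexHull_min (s := w '' Set.Ici k) ?_ (hconvint x s hs)
    · exact (hsub (huV k)).2
    · rintro _ ⟨j, hj, rfl⟩
      exact ⟨hw j, hN j (le_trans hk hj)⟩
  refine ⟨W, ⟨⟨?_, ?_, ?_⟩, ?_⟩, ?_, ?_, ?_⟩
  · intro x
    refine measurable_of_tendsto_metrizable (f := fun n => A.indicator (u n x))
      (fun n => ((hu n).meas x).indicator hAm) ?_
    rw [tendsto_pi_nhds]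
    intro ω
    by_cases h : ω ∈ A
    · simpa [h] using hWA ω h x
    · simp [h, hWn ω h x]
  · intro ω
    rw [lip_iff']
    intro x y
    by_cases h : ω ∈ A
    · exact le_of_tendsto ((hWA ω h x).sub (hWA ω h y)).abs
        (Eventually.of_forall fun n => (hu n).abs_sub_le x y ω)
    · rw [hWn ω h, hWn ω h]
      simp only [sub_self, abs_zero]
      positivity
  · intro ω
    by_cases h : ω ∈ A
    · refine tendsto_nhds_unique (hWA ω h 0) ?_
      simp [(hu _).zero]
    · exact hWn ω h 0
  · intro x z ω
    by_cases h : ω ∈ A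
    · refine tendsto_nhds_unique (hWA _ (hAst ω z h) x) ?_
      have h1 := (hus0 x z ω).add ((hWA ω h (x + z)).sub (hWA ω h z))
      rw [zero_add] at h1
      exact h1.congr fun n => by ring
    · have h' : τ z ω ∉ A := fun h2 => h (hAst' ω z h2)
      rw [hWn _ h', hWn _ h, hWn _ h, sub_self]
  · intro c hc
    obtain ⟨N, hN⟩ := eventually_atTop.1 hc
    have hsub : ∀ k ≥ N, SubC P c (u k) := by
      intro k hk
      have hsub := convexHull_min (s := w '' Set.Ici k) ?_ (convex_subC P c)
      · exact hsub (huV k)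
      · rintro _ ⟨j, hj, rfl⟩
        exact hN j (le_trans hk hj)
    have hall : ∀ᵐ ω ∂P, ∀ k, k ≥ N → ∀ a b, u k b ω - u k a ω ≤ c a b ω := by
      rw [ae_all_iff]
      intro k
      by_cases hk : k ≥ N
      · filter_upwards [hsub k hk] with ω h _ using h
      · exact Eventually.of_forall fun ω h => absurd h hk
    filter_upwards [hall, hPA] with ω h1 h2 a b
    refine le_of_tendsto ((hWA ω h2 b).sub (hWA ω h2 a)) ?_
    filter_upwards [eventually_ge_atTop N] with k hk using h1 k hk a b
  · intro x r h
    exact le_of_tendsto (hintW x) (hints x (Set.Iic r) (convex_Iic r) h)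
  · intro x r h
    exact ge_of_tendsto (hintW x) (hints x (Set.Ici r) (convex_Ici r) h)

end

/-! ### Sublinearity of stationary mean-zero processes -/

section
variable {d : ℕ} {Ω : Type*} [MeasurableSpace Ω]

/-- The maximal process of Garsia's argument. -/
def garsiaM (T : Ω → Ω) (f : Ω → ℝ) : ℕ → Ω → ℝ
  | 0 => fun _ => 0
  | n + 1 => fun ω => max 0 (f ω + garsiaM T f n (T ω))

lemma garsia (P : Measure Ω) [IsProbabilityMeasure P] {T : Ω → Ω} (hT : MeasurePreserving T P P)
    {f : Ω → ℝ} (hf : Measurable f) {B : ℝ} (hB : ∀ ω, |f ω| ≤ B) {S : ℕ → Ω → ℝ}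
    (hS0 : ∀ ω, S 0 ω = 0) (hS : ∀ n ω, S (n + 1) ω = f ω + S n (T ω))
    (hpos : ∀ᵐ ω ∂P, ∃ n, 0 < S n ω) : 0 ≤ ∫ ω, f ω ∂P := by
  set M := garsiaM T f with hM
  have hMm : ∀ n, Measurable (M n) := by
    intro n
    induction n with
    | zero => exact measurable_const
    | succ n ih => exact measurable_const.max (hf.add (ih.comp hT.measurable))
  have hM0 : ∀ n ω, 0 ≤ M n ω := by
    intro n ω
    cases n with
    | zero => exact le_refl _
    | succ n => exact le_max_left _ _
  have hMmono : ∀ n ω, M n ω ≤ M (n + 1) ω := by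
    intro n
    induction n with
    | zero => intro ω; exact hM0 1 ω
    | succ n ih =>
      intro ω
      exact max_le_max le_rfl (by linarith [ih (T ω)])
  have hMS : ∀ n ω, S n ω ≤ M n ω := by
    intro n
    induction n with
    | zero => intro ω; rw [hS0]; exact hM0 0 ω
    | succ n ih =>
      intro ω
      rw [hS]
      exact le_trans (by linarith [ih (T ω)]) (le_max_right _ _)
  have hMb : ∀ n ω, |M n ω| ≤ n * B := by
    intro n
    induction n with
    | zero => intro ω; simp [hM, garsiaM]
    | succ n ih =>
      intro ω
      rw [abs_of_nonneg (hM0 _ _)]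
      have h1 := ih (T ω)
      have h2 := hB ω
      rw [abs_le] at h1 h2
      have h3 : (0 : ℝ) ≤ n * B := by linarith
      refine max_le ?_ ?_ <;> push_cast <;> linarith
  have hMi : ∀ n, Integrable (M n) P := fun n =>
    Integrable.of_bound (hMm n).aestronglyMeasurable (n * B) (Eventually.of_forall (hMb n))
  have hfi : Integrable f P :=
    Integrable.of_bound hf.aestronglyMeasurable B (Eventually.of_forall hB)
  have hset : ∀ n, MeasurableSet {ω | 0 < M n ω} := fun n =>
    measurableSet_lt measurable_const (hMm n)
  have hge : ∀ n, 0 ≤ ∫ ω, {ω | 0 < M (n + 1) ω}.indicator f ω ∂P := by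
    intro n
    have hcomp : Integrable (fun ω => M (n + 1) (T ω)) P :=
      hT.integrable_comp_of_integrable (hMi (n + 1))
    have h1 : ∫ ω, (M (n + 1) ω - M (n + 1) (T ω)) ∂P = 0 := by
      rw [integral_sub (hMi _) hcomp, sub_eq_zero]
      have := integral_map (μ := P) hT.aemeasurable (f := M (n + 1))
        (hMm (n + 1)).aestronglyMeasurable
      rw [hT.map_eq] at this
      exact this
    refine h1.symm.le.trans ?_
    refine integral_mono ((hMi _).sub hcomp)
      (hfi.indicator (hset _)) fun ω => ?_
    by_cases h : 0 < M (n + 1) ω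
    · have h2 : M (n + 1) ω = f ω + M n (T ω) := by
        have h3 : M (n + 1) ω = max 0 (f ω + M n (T ω)) := rfl
        rw [h3] at h ⊢
        rcases lt_max_iff.1 h with h4 | h4
        · exact absurd h4 (lt_irrefl _)
        · exact max_eq_right h4.le
      have h5 := hMmono n (T ω)
      simp only [Set.indicator, Set.mem_ofPred_eq, h, if_true]
      linarith
    · simp only [Set.indicator, Set.mem_ofPred_eq, h, if_false]
      linarith [hM0 (n + 1) (T ω)]
  have hmono' : ∀ ω, Monotone fun n => M n ω := fun ω => monotone_nat_of_le_succ fun n => hMmono n ω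
  have hlim : Tendsto (fun n => ∫ ω, {ω | 0 < M (n + 1) ω}.indicator f ω ∂P) atTop
      (𝓝 (∫ ω, f ω ∂P)) := by
    refine tendsto_integral_of_dominated_convergence (fun _ => B)
      (fun n => (hf.indicator (hset _)).aestronglyMeasurable) (integrable_const _) ?_ ?_
    · intro n
      exact Eventually.of_forall fun ω => (norm_indicator_le_norm_self _ _).trans (hB ω)
    · filter_upwards [hpos] with ω ⟨n, hn⟩
      refine tendsto_const_nhds.congr' ?_
      filter_upwards [eventually_ge_atTop n] with m hm
      have : 0 < M (m + 1) ω := (hn.trans_le (hMS n ω)).trans_le (hmono' ω (by omega))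
      simp [Set.indicator, this]
  exact ge_of_tendsto hlim (Eventually.of_forall hge)

lemma StatProc.neg {τ : Ed d → Ω → Ω} {C : ℝ≥0} {w : Ed d → Ω → ℝ} (h : StatProc τ C w) :
    StatProc τ C (fun x ω => - w x ω) where
  meas x := (h.meas x).neg
  lip ω := by
    rw [lip_iff']
    intro x y
    rw [← abs_neg]
    have := h.abs_sub_le x y ω
    convert this using 2
    ring
  zero ω := by simp [h.zero]
  stat x z ω := by simp only [h.stat]; ring

lemma ray_bound (P : Measure Ω) [IsProbabilityMeasure P] {τ : Ed d → Ω → Ω}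
    (hτmp : ∀ y : Ed d, MeasurePreserving (τ y) P P)
    (hτgrp : ∀ x y : Ed d, τ (x + y) = τ x ∘ τ y) (hτzero : τ 0 = id)
    (hτerg : ∀ A : Set Ω, MeasurableSet A → (∀ z : Ed d, τ z ⁻¹' A = A) → P A = 0 ∨ P A = 1)
    {C : ℝ≥0} {w : Ed d → Ω → ℝ} (hw : StatProc τ C w) (h0 : ∀ x, ∫ ω, w x ω ∂P = 0)
    (e : Ed d) (α : ℝ) (hα : 0 < α) :
    ∀ᵐ ω ∂P, ∃ K : ℕ, ∀ n : ℕ, w ((n : ℝ) • e) ω ≤ n * α + K := by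
  let A : Set Ω := {ω | ∀ K : ℕ, ∃ n : ℕ, n * α + K < w ((n : ℝ) • e) ω}
  have hAm : MeasurableSet A := by
    have : A = ⋂ K : ℕ, ⋃ n : ℕ, {ω | n * α + K < w ((n : ℝ) • e) ω} := by
      ext ω; simp [A]
    rw [this]
    exact MeasurableSet.iInter fun K => MeasurableSet.iUnion fun n =>
      measurableSet_lt measurable_const (hw.meas _)
  have hsub : ∀ z ω, ω ∈ A → τ z ω ∈ A := by
    intro z ω hω K
    obtain ⟨L, hL⟩ := exists_nat_ge (K + 2 * (C * ‖z‖))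
    obtain ⟨n, hn⟩ := hω L
    refine ⟨n, ?_⟩
    rw [hw.stat]
    have h1 := hw.abs_sub_le ((n : ℝ) • e + z) ((n : ℝ) • e) ω
    have h2 := hw.abs_le z ω
    rw [add_sub_cancel_left] at h1
    rw [abs_le] at h1 h2
    linarith
  have hinv : ∀ z, τ z ⁻¹' A = A := by
    intro z
    ext ω
    refine ⟨fun h => ?_, fun h => hsub z ω h⟩
    have := hsub (-z) _ h
    have h2 : τ (-z) (τ z ω) = ω := by
      have := congrFun (hτgrp (-z) z) ω
      simp only [neg_add_cancel, hτzero, id, Function.comp] at this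
      exact this.symm
    rwa [h2] at this
  have hA0 : P A = 0 := by
    rcases hτerg A hAm hinv with h | h
    · exact h
    exfalso
    have hAae : ∀ᵐ ω ∂P, ω ∈ A := (prob_compl_eq_zero_iff hAm).2 h
    have hg := garsia P (hτmp e) (f := fun ω => w e ω - α) ((hw.meas e).sub_const α)
      (B := C * ‖e‖ + |α|) (fun ω => (abs_sub _ _).trans (by linarith [hw.abs_le e ω]))
      (S := fun n ω => w ((n : ℝ) • e) ω - n * α) (fun ω => by simp [hw.zero])
      (fun n ω => by
        simp only [hw.stat]
        push_cast
        rw [add_smul, one_smul]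
        ring)
      (by
        filter_upwards [hAae] with ω hω
        obtain ⟨n, hn⟩ := hω 0
        exact ⟨n, by push_cast at hn; linarith⟩)
    rw [integral_sub (hw.integrable P e) (integrable_const _), h0] at hg
    simp at hg
    linarith
  have : ∀ᵐ ω ∂P, ω ∉ A := measure_eq_zero_iff_ae_notMem.1 hA0
  filter_upwards [this] with ω hω
  simp only [A, Set.mem_ofPred_eq, not_forall, not_exists, not_lt] at hω
  exact hω

lemma sublinear_bound (P : Measure Ω) [IsProbabilityMeasure P] {τ : Ed d → Ω → Ω}
    (hτmp : ∀ y : Ed d, MeasurePreserving (τ y) P P)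
    (hτgrp : ∀ x y : Ed d, τ (x + y) = τ x ∘ τ y) (hτzero : τ 0 = id)
    (hτerg : ∀ A : Set Ω, MeasurableSet A → (∀ z : Ed d, τ z ⁻¹' A = A) → P A = 0 ∨ P A = 1)
    {C : ℝ≥0} {w : Ed d → Ω → ℝ} (hw : StatProc τ C w) (h0 : ∀ x, ∫ ω, w x ω ∂P = 0) :
    ∀ᵐ ω ∂P, ∀ ε : ℝ, 0 < ε → ∃ K : ℝ, ∀ y, |w y ω| ≤ ε * ‖y‖ + K := by
  set xs : ℕ → Ed d := TopologicalSpace.denseSeq (Ed d)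
  have hxs : DenseRange xs := TopologicalSpace.denseRange_denseSeq _
  have h1 : ∀ᵐ ω ∂P, ∀ i j : ℕ, ∃ K : ℕ, ∀ n : ℕ,
      w ((n : ℝ) • xs i) ω ≤ n * (1 / ((j : ℝ) + 1)) + K := by
    rw [ae_all_iff]; intro i; rw [ae_all_iff]; intro j
    exact ray_bound P hτmp hτgrp hτzero hτerg hw h0 (xs i) _ (by positivity)
  have h2 : ∀ᵐ ω ∂P, ∀ i j : ℕ, ∃ K : ℕ, ∀ n : ℕ,
      - w ((n : ℝ) • xs i) ω ≤ n * (1 / ((j : ℝ) + 1)) + K := by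
    rw [ae_all_iff]; intro i; rw [ae_all_iff]; intro j
    exact ray_bound P hτmp hτgrp hτzero hτerg hw.neg
      (fun x => by rw [integral_neg, h0, neg_zero]) (xs i) _ (by positivity)
  filter_upwards [h1, h2] with ω h1 h2 ε hε
  obtain ⟨j, hj⟩ := exists_nat_one_div_lt (show 0 < ε / 2 by positivity)
  set η : ℝ := ε / (2 * (C + 1)) with hη
  have hηpos : 0 < η := by positivity
  have hCη : C * η ≤ ε / 2 := by
    have : (C + 1) * η = ε / 2 := by rw [hη]; field_simp
    nlinarith
  have hcov : Metric.closedBall (0 : Ed d) 1 ⊆ ⋃ i : ℕ, Metric.ball (xs i) η := by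
    intro θ _
    obtain ⟨i, hi⟩ := hxs.exists_dist_lt θ hηpos
    exact Set.mem_iUnion.2 ⟨i, hi⟩
  obtain ⟨t, ht⟩ := (isCompact_closedBall (0 : Ed d) 1).elim_finite_subcover _
    (fun i => Metric.isOpen_ball) hcov
  choose K hK using fun i => h1 i j
  choose K' hK' using fun i => h2 i j
  refine ⟨C + ∑ i ∈ t, ((K i : ℝ) + K' i), fun y => ?_⟩
  set n := ⌊‖y‖⌋₊ with hn
  have hn1 : (n : ℝ) ≤ ‖y‖ := Nat.floor_le (norm_nonneg y)
  have hn2 : ‖y‖ < n + 1 := Nat.lt_floor_add_one _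
  obtain ⟨θ, hθ1, hθ⟩ : ∃ θ : Ed d, ‖θ‖ ≤ 1 ∧ ‖y - (n : ℝ) • θ‖ ≤ 1 := by
    by_cases hy : y = 0
    · exact ⟨0, by simp, by simp [hy]⟩
    · have hy' : 0 < ‖y‖ := norm_pos_iff.2 hy
      refine ⟨‖y‖⁻¹ • y, ?_, ?_⟩
      · rw [norm_smul, norm_inv, norm_norm, inv_mul_cancel₀ hy'.ne']
      · have : y - (n : ℝ) • (‖y‖⁻¹ • y) = (1 - n * ‖y‖⁻¹) • y := by
          rw [sub_smul, one_smul, smul_smul]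
        rw [this, norm_smul, Real.norm_eq_abs]
        have h3 : |1 - n * ‖y‖⁻¹| * ‖y‖ = |‖y‖ - n| := by
          rw [← abs_of_pos hy', ← abs_mul, abs_of_pos hy']
          congr 1
          field_simp
        rw [h3, abs_le]
        constructor <;> linarith
  have hθm : θ ∈ Metric.closedBall (0 : Ed d) 1 := by simpa using hθ1
  obtain ⟨i, hit, hi⟩ := Set.mem_iUnion₂.1 (ht hθm)
  have hi' : ‖θ - xs i‖ < η := by rwa [Metric.mem_ball, dist_eq_norm] at hi
  have hdist : ‖y - (n : ℝ) • xs i‖ ≤ 1 + n * η := by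
    have : y - (n : ℝ) • xs i = (y - (n : ℝ) • θ) + (n : ℝ) • (θ - xs i) := by
      rw [smul_sub]; abel
    rw [this]
    refine (norm_add_le _ _).trans (add_le_add hθ ?_)
    rw [norm_smul, Real.norm_natCast]
    gcongr
  have hL := hw.abs_sub_le y ((n : ℝ) • xs i) ω
  have hL2 : (C : ℝ) * ‖y - (n : ℝ) • xs i‖ ≤ C * (1 + n * η) := by gcongr
  have hKi : (K i : ℝ) + K' i ≤ ∑ i ∈ t, ((K i : ℝ) + K' i) :=
    Finset.single_le_sum (f := fun i => (K i : ℝ) + K' i) (fun i _ => by positivity) hit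
  have e1 := hK i n
  have e2 := hK' i n
  have e3 : (n : ℝ) * (1 / ((j : ℝ) + 1)) ≤ ‖y‖ * (ε / 2) := by gcongr
  have e4 : n * (C * η) ≤ ‖y‖ * (ε / 2) := by gcongr
  have e5 : (0 : ℝ) ≤ K i := by positivity
  have e6 : (0 : ℝ) ≤ K' i := by positivity
  rw [abs_le] at hL ⊢
  constructor <;> nlinarith

lemma tendsto_of_bound {u : Ed d → ℝ}
    (h : ∀ ε : ℝ, 0 < ε → ∃ K : ℝ, ∀ y, |u y| ≤ ε * ‖y‖ + K) :
    Tendsto (fun y => u y / ‖y‖) (cobounded (Ed d)) (𝓝 0) := by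
  rw [Metric.tendsto_nhds]
  intro ε hε
  obtain ⟨K, hK⟩ := h (ε / 2) (by positivity)
  have h1 := (tendsto_norm_cobounded_atTop (E := Ed d)).eventually_gt_atTop (max 0 (2 * K / ε))
  filter_upwards [h1] with y hy
  have hy0 : 0 < ‖y‖ := (le_max_left _ _).trans_lt hy
  have hy1 : 2 * K / ε < ‖y‖ := (le_max_right _ _).trans_lt hy
  rw [div_lt_iff₀ hε] at hy1
  rw [Real.dist_eq, sub_zero, abs_div, abs_norm, div_lt_iff₀ hy0]
  linarith [hK y]

lemma scal_of_bound {C : ℝ≥0} {u : Ed d → ℝ} (hu : LipschitzWith C u)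
    (h : ∀ ε : ℝ, 0 < ε → ∃ K : ℝ, ∀ y, |u y| ≤ ε * ‖y‖ + K) : u ∈ Scal d := by
  have key : ∀ ε : ℝ, 0 < ε → ∃ R : ℝ, ∀ y : Ed d, R ≤ ‖y‖ → |u y / ‖y‖| ≤ ε := by
    intro ε hε
    obtain ⟨K, hK⟩ := h (ε / 2) (by positivity)
    refine ⟨max 1 (2 * K / ε), fun y hy => ?_⟩
    have hy0 : 0 < ‖y‖ := by linarith [(le_max_left _ _).trans hy]
    have hy1 : 2 * K / ε ≤ ‖y‖ := (le_max_right _ _).trans hy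
    rw [div_le_iff₀ hε] at hy1
    rw [abs_div, abs_norm, div_le_iff₀ hy0]
    linarith [hK y]
  refine ⟨⟨⟨C, hu⟩, fun ε hε => ?_⟩, ⟨⟨C, hu⟩, fun ε hε => ?_⟩⟩
  · obtain ⟨R, hR⟩ := key ε hε
    exact ⟨R, fun y hy => (abs_le.1 (hR y hy)).1⟩
  · obtain ⟨R, hR⟩ := key ε hε
    exact ⟨R, fun y hy => (abs_le.1 (hR y hy)).2⟩

end

/-! ### The intrinsic (chain) metric -/

section
variable {d : ℕ}

/-- Cost of a chain from `x` to `y` through the points of a list. -/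
def chainCost (k : Ed d → Ed d → ℝ) : List (Ed d) → Ed d → Ed d → ℝ
  | [], x, y => k x y
  | z :: l, x, y => k x z + chainCost k l z y

/-- Infimum of the chain costs. -/
def chainInf (k : Ed d → Ed d → ℝ) (x y : Ed d) : ℝ := ⨅ l, chainCost k l x y

lemma chainCost_append (k : Ed d → Ed d → ℝ) (l : List (Ed d)) (x a b : Ed d) :
    chainCost k (l ++ [a]) x b = chainCost k l x a + k a b := by
  induction l generalizing x with
  | nil => rfl
  | cons z l ih => simp only [List.cons_append, chainCost, ih]; ring

lemma chain_bdd {k : Ed d → Ed d → ℝ} {C : ℝ} (hk : ∀ a b, k a b ≤ C * ‖b - a‖) {x y : Ed d}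
    (h : BddBelow (Set.range fun l => chainCost k l x y)) (x' y' : Ed d) :
    BddBelow (Set.range fun l => chainCost k l x' y') := by
  obtain ⟨B, hB⟩ := h
  refine ⟨B - C * ‖x' - x‖ - C * ‖y - y'‖, ?_⟩
  rintro _ ⟨l, rfl⟩
  have h1 : B ≤ chainCost k (x' :: (l ++ [y'])) x y := hB ⟨_, rfl⟩
  simp only [chainCost, chainCost_append] at h1
  simp only
  linarith [hk x x', hk y' y]

/-- Chain costs are bounded below. -/
def ChainGood (k : Ed d → Ed d → ℝ) : Prop :=
  ∀ x y, BddBelow (Set.range fun l => chainCost k l x y)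

lemma chainInf_of_not_good {k : Ed d → Ed d → ℝ} {C : ℝ} (hk : ∀ a b, k a b ≤ C * ‖b - a‖)
    (h : ¬ ChainGood k) (x y : Ed d) : chainInf k x y = 0 := by
  apply Real.iInf_of_not_bddBelow
  intro h2
  exact h fun x' y' => chain_bdd hk h2 x' y'

lemma chainInf_right {k : Ed d → Ed d → ℝ} (h : ChainGood k) (x a b : Ed d) :
    chainInf k x b - chainInf k x a ≤ k a b := by
  have : chainInf k x b - k a b ≤ chainInf k x a := by
    refine le_ciInf fun l => ?_
    have := ciInf_le (h x b) (l ++ [a])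
    rw [chainCost_append] at this
    unfold chainInf
    linarith
  linarith

lemma chainInf_left {k : Ed d → Ed d → ℝ} (h : ChainGood k) (x x' y : Ed d) :
    chainInf k x y - chainInf k x' y ≤ k x x' := by
  have : chainInf k x y - k x x' ≤ chainInf k x' y := by
    refine le_ciInf fun l => ?_
    have := ciInf_le (h x y) (x' :: l)
    simp only [chainCost] at this
    unfold chainInf
    linarith
  linarith

lemma chainInf_lip_right {k : Ed d → Ed d → ℝ} {C : ℝ} (hC : 0 ≤ C)
    (hk : ∀ a b, k a b ≤ C * ‖b - a‖) (x a b : Ed d) :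
    |chainInf k x a - chainInf k x b| ≤ C * ‖a - b‖ := by
  by_cases h : ChainGood k
  · have h1 := (chainInf_right h x a b).trans (hk a b)
    have h2 := (chainInf_right h x b a).trans (hk b a)
    rw [norm_sub_rev] at h1
    rw [abs_le]; constructor <;> linarith
  · rw [chainInf_of_not_good hk h, chainInf_of_not_good hk h]
    simp only [sub_self, abs_zero]; positivity

lemma chainInf_lip_left {k : Ed d → Ed d → ℝ} {C : ℝ} (hC : 0 ≤ C)
    (hk : ∀ a b, k a b ≤ C * ‖b - a‖) (a b y : Ed d) :
    |chainInf k a y - chainInf k b y| ≤ C * ‖a - b‖ := by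
  by_cases h : ChainGood k
  · have h1 := (chainInf_left h a b y).trans (hk a b)
    have h2 := (chainInf_left h b a y).trans (hk b a)
    rw [norm_sub_rev] at h1
    rw [abs_le]; constructor <;> linarith
  · rw [chainInf_of_not_good hk h, chainInf_of_not_good hk h]
    simp only [sub_self, abs_zero]; positivity

lemma chain_ge {k : Ed d → Ed d → ℝ} {u : Ed d → ℝ} (hu : ∀ a b, u b - u a ≤ k a b)
    (l : List (Ed d)) (x y : Ed d) : u y - u x ≤ chainCost k l x y := by
  induction l generalizing x with
  | nil => exact hu x y
  | cons z l ih => simp only [chainCost]; linarith [hu x z, ih z]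

lemma chainGood_of_sub {k : Ed d → Ed d → ℝ} {u : Ed d → ℝ} (hu : ∀ a b, u b - u a ≤ k a b) :
    ChainGood k := fun x y => ⟨u y - u x, by rintro _ ⟨l, rfl⟩; exact chain_ge hu l x y⟩

lemma chainInf_ge {k : Ed d → Ed d → ℝ} {u : Ed d → ℝ} (hu : ∀ a b, u b - u a ≤ k a b)
    (x y : Ed d) : u y - u x ≤ chainInf k x y := le_ciInf fun l => chain_ge hu l x y

lemma continuous_chainCost {k : Ed d → Ed d → ℝ}
    (hk : Continuous fun q : Ed d × Ed d => k q.1 q.2) (l : List (Ed d)) (y : Ed d) :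
    Continuous fun x => chainCost k l x y := by
  cases l with
  | nil => exact hk.comp (continuous_id.prodMk continuous_const)
  | cons z l => exact (hk.comp (continuous_id.prodMk continuous_const)).add continuous_const

lemma chain_dense {k : Ed d → Ed d → ℝ} (hk : Continuous fun q : Ed d × Ed d => k q.1 q.2)
    {xs : ℕ → Ed d} (hxs : DenseRange xs) (l : List (Ed d)) (x y : Ed d) (ε : ℝ) (hε : 0 < ε) :
    ∃ l' : List ℕ, chainCost k (l'.map xs) x y < chainCost k l x y + ε := by
  induction l generalizing x ε with
  | nil => exact ⟨[], by simp [chainCost, hε]⟩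
  | cons z l ih =>
    have hc : Continuous fun z' => k x z' + chainCost k l z' y :=
      (hk.comp (continuous_const.prodMk continuous_id)).add (continuous_chainCost hk l y)
    have hopen : IsOpen {z' | k x z' + chainCost k l z' y < k x z + chainCost k l z y + ε / 2} :=
      isOpen_lt hc continuous_const
    obtain ⟨i, hi⟩ := hxs.exists_mem_open hopen ⟨z, by simp [hε]⟩
    obtain ⟨l', hl'⟩ := ih (xs i) (ε / 2) (by positivity)
    refine ⟨i :: l', ?_⟩
    simp only [List.map_cons, chainCost]
    simp only [Set.mem_ofPred_eq] at hi
    linarith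

lemma chainInf_eq_dense {k : Ed d → Ed d → ℝ} (hk : Continuous fun q : Ed d × Ed d => k q.1 q.2)
    {xs : ℕ → Ed d} (hxs : DenseRange xs) (x y : Ed d) :
    chainInf k x y = ⨅ l' : List ℕ, chainCost k (l'.map xs) x y := by
  by_cases h : BddBelow (Set.range fun l => chainCost k l x y)
  · have h' : BddBelow (Set.range fun l' : List ℕ => chainCost k (l'.map xs) x y) := by
      obtain ⟨B, hB⟩ := h
      exact ⟨B, by rintro _ ⟨l', rfl⟩; exact hB ⟨_, rfl⟩⟩
    refine le_antisymm (le_ciInf fun l' => ciInf_le h _) (le_ciInf fun l => ?_)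
    refine le_of_forall_pos_lt_add fun ε hε => ?_
    obtain ⟨l', hl'⟩ := chain_dense hk hxs l x y ε hε
    exact (ciInf_le h' l').trans_lt hl'
  · rw [chainInf, Real.iInf_of_not_bddBelow h, Real.iInf_of_not_bddBelow]
    rintro ⟨B, hB⟩
    refine h ⟨B - 1, ?_⟩
    rintro _ ⟨l, rfl⟩
    obtain ⟨l', hl'⟩ := chain_dense hk hxs l x y 1 one_pos
    have : B ≤ chainCost k (l'.map xs) x y := hB ⟨l', rfl⟩
    simp only
    linarith

lemma chainCost_shift {k k' : Ed d → Ed d → ℝ} {z : Ed d}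
    (h : ∀ a b, k' a b = k (a + z) (b + z)) (l : List (Ed d)) (x y : Ed d) :
    chainCost k' l x y = chainCost k (l.map (· + z)) (x + z) (y + z) := by
  induction l generalizing x with
  | nil => exact h x y
  | cons a l ih => simp only [List.map_cons, chainCost, ih, h]

lemma chainInf_shift {k k' : Ed d → Ed d → ℝ} {z : Ed d}
    (h : ∀ a b, k' a b = k (a + z) (b + z)) (x y : Ed d) :
    chainInf k' x y = chainInf k (x + z) (y + z) := by
  unfold chainInf
  refine Function.Surjective.iInf_congr (fun l => l.map (· + z)) ?_ ?_
  · intro l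
    refine ⟨l.map (· + -z), ?_⟩
    simp [List.map_map, Function.comp_def]
  · intro l
    exact (chainCost_shift h l x y).symm

end

section
variable {d : ℕ} {Ω : Type*} [MeasurableSpace Ω]

/-- Admissible stationary costs. -/
structure IsCost (τ : Ed d → Ω → Ω) (C : ℝ≥0) (c : Ed d → Ed d → Ω → ℝ) : Prop where
  meas : ∀ a b, Measurable (c a b)
  cont : ∀ ω, Continuous fun q : Ed d × Ed d => c q.1 q.2 ω
  le : ∀ a b ω, c a b ω ≤ C * ‖b - a‖
  stat : ∀ a b z ω, c a b (τ z ω) = c (a + z) (b + z) ω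

/-- The random chain metric. -/
def mCh (c : Ed d → Ed d → Ω → ℝ) (x y : Ed d) (ω : Ω) : ℝ := chainInf (fun a b => c a b ω) x y

variable {τ : Ed d → Ω → Ω} {C : ℝ≥0} {c : Ed d → Ed d → Ω → ℝ}

lemma mCh_meas (hc : IsCost τ C c) (x y : Ed d) : Measurable (mCh c x y) := by
  have hxs : DenseRange (TopologicalSpace.denseSeq (Ed d)) :=
    TopologicalSpace.denseRange_denseSeq _
  have : mCh c x y = fun ω => ⨅ l' : List ℕ, chainCost (fun a b => c a b ω)
      (l'.map (TopologicalSpace.denseSeq (Ed d))) x y := by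
    ext ω
    exact chainInf_eq_dense (hc.cont ω) hxs x y
  rw [this]
  refine Measurable.iInf fun l' => ?_
  generalize l'.map (TopologicalSpace.denseSeq (Ed d)) = l
  induction l generalizing x with
  | nil => exact hc.meas x y
  | cons z l ih =>
    simp only [chainCost]
    exact (hc.meas x z).add (ih z (by ext ω; exact chainInf_eq_dense (hc.cont ω) hxs z y))

lemma mCh_stat (hc : IsCost τ C c) (x y z : Ed d) (ω : Ω) :
    mCh c x y (τ z ω) = mCh c (x + z) (y + z) ω :=
  chainInf_shift (fun a b => hc.stat a b z ω) x y

lemma mCh_right (hc : IsCost τ C c) (x a b : Ed d) (ω : Ω) :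
    |mCh c x a ω - mCh c x b ω| ≤ C * ‖a - b‖ :=
  chainInf_lip_right C.2 (fun a b => hc.le a b ω) x a b

lemma mCh_left (hc : IsCost τ C c) (a b y : Ed d) (ω : Ω) :
    |mCh c a y ω - mCh c b y ω| ≤ C * ‖a - b‖ :=
  chainInf_lip_left C.2 (fun a b => hc.le a b ω) a b y

end

/-! ### Averages over balls -/

section
variable {d : ℕ}

/-- Average over the ball of radius `R`. -/
def ballAvg (R : ℝ) (φ : Ed d → ℝ) : ℝ :=
  (volume.real (Metric.ball (0 : Ed d) R))⁻¹ * ∫ v in Metric.ball (0 : Ed d) R, φ v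

lemma ball_pos {R : ℝ} (hR : 0 < R) : 0 < volume.real (Metric.ball (0 : Ed d) R) :=
  ENNReal.toReal_pos (Metric.measure_ball_pos volume 0 hR).ne' measure_ball_lt_top.ne

lemma intOn_ball {φ : Ed d → ℝ} (h : Continuous φ) (x : Ed d) (R : ℝ) :
    IntegrableOn φ (Metric.ball x R) :=
  (h.continuousOn.integrableOn_compact (isCompact_closedBall x R)).mono_set
    Metric.ball_subset_closedBall

lemma ballAvg_sub {R : ℝ} {φ ψ : Ed d → ℝ} (hφ : Continuous φ) (hψ : Continuous ψ) :
    ballAvg R (fun v => φ v - ψ v) = ballAvg R φ - ballAvg R ψ := by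
  unfold ballAvg
  rw [integral_sub (intOn_ball hφ _ _) (intOn_ball hψ _ _), mul_sub]

lemma ballAvg_le {R : ℝ} (hR : 0 < R) {φ : Ed d → ℝ} (hφ : Continuous φ) {s : ℝ}
    (h : ∀ v, ‖v‖ ≤ R → φ v ≤ s) : ballAvg R φ ≤ s := by
  unfold ballAvg
  have h1 : ∫ v in Metric.ball (0 : Ed d) R, φ v ≤ ∫ v in Metric.ball (0 : Ed d) R, s := by
    refine setIntegral_mono_on (intOn_ball hφ _ _) (intOn_ball continuous_const _ _)
      measurableSet_ball fun v hv => h v ?_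
    exact (mem_ball_zero_iff.1 hv).le
  rw [setIntegral_const, smul_eq_mul] at h1
  rw [inv_mul_le_iff₀ (ball_pos hR)]
  exact h1

lemma ballAvg_const {R : ℝ} (hR : 0 < R) (s : ℝ) : ballAvg R (fun _ : Ed d => s) = s := by
  unfold ballAvg
  rw [setIntegral_const, smul_eq_mul, inv_mul_cancel_left₀ (ball_pos hR).ne']

lemma ballAvg_abs_le {R : ℝ} (hR : 0 < R) {φ : Ed d → ℝ} (hφ : Continuous φ) {s : ℝ}
    (h : ∀ v, ‖v‖ ≤ R → |φ v| ≤ s) : |ballAvg R φ| ≤ s := by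
  rw [abs_le]
  constructor
  · have := ballAvg_le hR (hφ.neg) (s := s) fun v hv => (neg_le_abs _).trans (h v hv)
    have e : ballAvg R (fun v => - φ v) = - ballAvg R φ := by
      unfold ballAvg; rw [integral_neg, mul_neg]
    change ballAvg R (fun v => - φ v) ≤ s at this
    linarith
  · exact ballAvg_le hR hφ fun v hv => (le_abs_self _).trans (h v hv)

lemma ballAvg_shift {R : ℝ} (hR : 0 < R) {φ : Ed d → ℝ} (hφ : Continuous φ) {S : ℝ}
    (h : ∀ v, |φ v| ≤ S) (z : Ed d) :
    |ballAvg R (fun v => φ (v + z)) - ballAvg R φ| ≤ 2 * S * ((1 + ‖z‖ / R) ^ d - 1) := by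
  have hS : 0 ≤ S := (abs_nonneg _).trans (h 0)
  set V : ℝ := volume.real (Metric.ball (0 : Ed d) R) with hV
  have hVp : 0 < V := ball_pos hR
  set D := Metric.ball (0 : Ed d) (R + ‖z‖) with hD
  have hDv : volume.real D = V * (1 + ‖z‖ / R) ^ d := by
    have e1 := Measure.addHaar_ball_mul_of_pos (volume : Measure (Ed d)) 0
      (r := 1 + ‖z‖ / R) (by positivity) R
    have e2 : (1 + ‖z‖ / R) * R = R + ‖z‖ := by field_simp
    rw [e2] at e1
    rw [hD, Measure.real, e1, ENNReal.toReal_mul, ENNReal.toReal_ofReal (by positivity), hV,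
      Measure.real, finrank_euclideanSpace_fin, mul_comm]
  have key : ∀ x : Ed d, Metric.ball x R ⊆ D → volume.real (Metric.ball x R) = V →
      |(∫ v in D, φ v) - ∫ v in Metric.ball x R, φ v| ≤ S * (volume.real D - V) := by
    intro x hx hxV
    rw [← setIntegral_sdiff measurableSet_ball (intOn_ball hφ _ _) hx, ← hxV,
      ← measureReal_sdiff hx measurableSet_ball]
    have := norm_setIntegral_le_of_norm_le_const (μ := volume) (s := D \ Metric.ball x R) (f := φ) (C := S)
      ((measure_mono Set.sdiff_subset).trans_lt measure_ball_lt_top) (fun v _ => h v)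
    exact this
  have k1 := key 0 (Metric.ball_subset_ball (by linarith [norm_nonneg z])) rfl
  have k2 := key z (by
    refine Metric.ball_subset_ball' ?_
    simp) (by rw [hV]; exact Measure.addHaar_real_ball_center _ _ _)
  have e3 : ∫ v in Metric.ball (0 : Ed d) R, φ (v + z) = ∫ v in Metric.ball z R, φ v := by
    have := (measurePreserving_add_right (volume : Measure (Ed d)) z).setIntegral_preimage_emb
      (measurableEmbedding_addRight z) φ (Metric.ball z R)
    rw [← this]
    congr 2
    ext v
    simp [dist_eq_norm]
  unfold ballAvg
  rw [← hV, e3, ← mul_sub, abs_mul, abs_of_pos (inv_pos.2 hVp), inv_mul_le_iff₀ hVp]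
  rw [hDv] at k1 k2
  have : V * (2 * S * ((1 + ‖z‖ / R) ^ d - 1)) = 2 * (S * (V * (1 + ‖z‖ / R) ^ d - V)) := by ring
  rw [this]
  rw [abs_le] at *
  constructor <;> linarith [k1.1, k1.2, k2.1, k2.2]
end

/-! ### Averaged chain metrics -/

section
variable {d : ℕ} {Ω : Type*} [MeasurableSpace Ω]
variable {τ : Ed d → Ω → Ω} {C : ℝ≥0} {c : Ed d → Ed d → Ω → ℝ}

/-- Averaged increment of the chain metrics with base points `v + (i+1) e`. -/
def mF (c : Ed d → Ed d → Ω → ℝ) (e : Ed d) (N : ℕ) (v x : Ed d) (ω : Ω) : ℝ :=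
  (N : ℝ)⁻¹ * ∑ i ∈ Finset.range N,
    (mCh c (v + ((i : ℝ) + 1) • e) x ω - mCh c (v + ((i : ℝ) + 1) • e) 0 ω)

lemma mCh_cont_left (hc : IsCost τ C c) (y : Ed d) (ω : Ω) : Continuous fun x => mCh c x y ω :=
  (lip_iff'.2 fun a b => mCh_left hc a b y ω : LipschitzWith C fun x => mCh c x y ω).continuous

lemma mF_cont (hc : IsCost τ C c) (e : Ed d) (N : ℕ) (x : Ed d) (ω : Ω) :
    Continuous fun v => mF c e N v x ω := by
  unfold mF
  refine continuous_const.mul (continuous_finsetSum _ fun i _ => ?_)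
  exact ((mCh_cont_left hc x ω).comp (continuous_id.add continuous_const)).sub
    ((mCh_cont_left hc 0 ω).comp (continuous_id.add continuous_const))

lemma mF_meas (hc : IsCost τ C c) (e : Ed d) (N : ℕ) (v x : Ed d) :
    Measurable fun ω => mF c e N v x ω := by
  unfold mF
  refine Measurable.const_mul (Finset.measurable_fun_sum _ fun i _ => ?_) _
  exact (mCh_meas hc _ _).sub (mCh_meas hc _ _)

lemma avg_le {N : ℕ} (hN : 0 < N) {f : ℕ → ℝ} {s : ℝ} (h : ∀ i, f i ≤ s) :
    (N : ℝ)⁻¹ * ∑ i ∈ Finset.range N, f i ≤ s := by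
  have : (0:ℝ) < N := by exact_mod_cast hN
  rw [inv_mul_le_iff₀ this]
  calc _ ≤ ∑ i ∈ Finset.range N, s := Finset.sum_le_sum fun i _ => h i
    _ = N * s := by simp

lemma mF_diff (e : Ed d) (N : ℕ) (v x y : Ed d) (ω : Ω) :
    mF c e N v x ω - mF c e N v y ω = (N : ℝ)⁻¹ * ∑ i ∈ Finset.range N,
    (mCh c (v + ((i : ℝ) + 1) • e) x ω - mCh c (v + ((i : ℝ) + 1) • e) y ω) := by
  unfold mF
  rw [← mul_sub, ← Finset.sum_sub_distrib]
  congr 1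
  exact Finset.sum_congr rfl fun i _ => by ring

lemma mF_lip (hc : IsCost τ C c) (e : Ed d) {N : ℕ} (hN : 0 < N) (v x y : Ed d) (ω : Ω) :
    |mF c e N v x ω - mF c e N v y ω| ≤ C * ‖x - y‖ := by
  rw [abs_le]
  constructor
  · rw [neg_le, neg_sub, mF_diff, norm_sub_rev]
    exact avg_le hN fun i => (le_abs_self _).trans (mCh_right hc _ _ _ _)
  · rw [mF_diff]
    exact avg_le hN fun i => (le_abs_self _).trans (mCh_right hc _ _ _ _)

lemma mF_sub (e : Ed d) {N : ℕ} (hN : 0 < N) (v a b : Ed d) (ω : Ω)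
    (h : ChainGood fun a b => c a b ω) :
    mF c e N v b ω - mF c e N v a ω ≤ c a b ω := by
  rw [mF_diff]
  exact avg_le hN fun i => chainInf_right h _ _ _

lemma mF_stat (hc : IsCost τ C c) (e : Ed d) (N : ℕ) (v x z : Ed d) (ω : Ω) :
    mF c e N v x (τ z ω) = mF c e N (v + z) (x + z) ω - mF c e N (v + z) z ω := by
  rw [mF_diff, mF]
  congr 1
  refine Finset.sum_congr rfl fun i _ => ?_
  rw [mCh_stat hc, mCh_stat hc, zero_add, add_right_comm]

/-- Ball average of `mF`. -/
def mW (c : Ed d → Ed d → Ω → ℝ) (e : Ed d) (N : ℕ) (R : ℝ) (x : Ed d) (ω : Ω) : ℝ :=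
  ballAvg R fun v => mF c e N v x ω

lemma mF_meas2 (hc : IsCost τ C c) (e : Ed d) (N : ℕ) (x : Ed d) :
    Measurable fun q : Ed d × Ω => mF c e N q.1 x q.2 :=
  measurable_uncurry_of_continuous_of_measurable (u := fun v ω => mF c e N v x ω)
    (fun ω => mF_cont hc e N x ω) (fun v => mF_meas hc e N v x)

lemma mW_pre (hc : IsCost τ C c) (e : Ed d) {N : ℕ} (hN : 0 < N) {R : ℝ} (hR : 0 < R) :
    PreProc C (mW c e N R) := by
  refine ⟨fun x => ?_, fun ω => ?_, fun ω => ?_⟩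
  · unfold mW ballAvg
    refine Measurable.const_mul ?_ _
    exact ((mF_meas2 hc e N x).stronglyMeasurable.integral_prod_left'
      (μ := volume.restrict (Metric.ball (0 : Ed d) R))).measurable
  · rw [lip_iff']
    intro x y
    unfold mW
    rw [← ballAvg_sub (mF_cont hc e N x ω) (mF_cont hc e N y ω)]
    exact ballAvg_abs_le hR ((mF_cont hc e N x ω).sub (mF_cont hc e N y ω))
      fun v _ => mF_lip hc e hN v x y ω
  · simp [mW, mF, ballAvg]

lemma mW_sub (hc : IsCost τ C c) (e : Ed d) {N : ℕ} (hN : 0 < N) {R : ℝ} (hR : 0 < R)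
    (a b : Ed d) (ω : Ω) (h : ChainGood fun a b => c a b ω) :
    mW c e N R b ω - mW c e N R a ω ≤ c a b ω := by
  unfold mW
  rw [← ballAvg_sub (mF_cont hc e N b ω) (mF_cont hc e N a ω)]
  exact ballAvg_le hR ((mF_cont hc e N b ω).sub (mF_cont hc e N a ω))
      fun v _ => mF_sub e hN v a b ω h

lemma mW_stat (hc : IsCost τ C c) (e : Ed d) {N : ℕ} (hN : 0 < N) {R : ℝ} (hR : 0 < R)
    (x z : Ed d) (ω : Ω) :
    |mW c e N R x (τ z ω) - (mW c e N R (x + z) ω - mW c e N R z ω)| ≤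
      2 * (C * ‖x‖) * ((1 + ‖z‖ / R) ^ d - 1) := by
  unfold mW
  rw [← ballAvg_sub (mF_cont hc e N _ ω) (mF_cont hc e N _ ω)]
  simp only [mF_stat hc]
  refine ballAvg_shift hR (φ := fun v => mF c e N v (x + z) ω - mF c e N v z ω)
    ((mF_cont hc e N _ ω).sub (mF_cont hc e N _ ω)) (fun v => ?_) z
  simpa using mF_lip hc e hN v (x + z) z ω

end

/-! ### The slope estimate -/

section
variable {d : ℕ} {Ω : Type*} [MeasurableSpace Ω]
variable {τ : Ed d → Ω → Ω} {C : ℝ≥0} {c : Ed d → Ed d → Ω → ℝ}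

/-- Almost sure existence of a dominated function in `SLplus`. -/
def HasSub (P : Measure Ω) (c : Ed d → Ed d → Ω → ℝ) : Prop :=
  ∀ᵐ ω ∂P, ∃ u ∈ SLplus d, ∀ a b, u b - u a ≤ c a b ω

lemma mCh_abs (hc : IsCost τ C c) {ω : Ω} {u : Ed d → ℝ} (hu : ∀ a b, u b - u a ≤ c a b ω)
    (x y : Ed d) : |mCh c x y ω| ≤ C * ‖y - x‖ := by
  have h0 : mCh c x x ω = 0 := by
    apply le_antisymm
    · have := ciInf_le (chainGood_of_sub hu x x) []
      refine this.trans ?_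
      have := hc.le x x ω
      rw [sub_self, norm_zero, mul_zero] at this
      exact this
    · have := chainInf_ge hu x x
      rw [sub_self] at this
      exact this
  simpa [h0] using mCh_right hc x y x ω

lemma mCh_integrable {P : Measure Ω} [IsProbabilityMeasure P] (hc : IsCost τ C c)
    (hs : HasSub P c) (x y : Ed d) : Integrable (mCh c x y) P := by
  refine Integrable.of_bound (mCh_meas hc x y).aestronglyMeasurable (C * ‖y - x‖) ?_
  filter_upwards [hs] with ω hω
  obtain ⟨u, -, hu⟩ := hω
  exact mCh_abs hc hu x y

/-- Mean chain metric. -/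
def mG (P : Measure Ω) (c : Ed d → Ed d → Ω → ℝ) (y : Ed d) : ℝ := ∫ ω, mCh c 0 y ω ∂P

lemma mG_eq {P : Measure Ω} [IsProbabilityMeasure P] (hτmp : ∀ y : Ed d, MeasurePreserving (τ y) P P)
    (hc : IsCost τ C c) (x y : Ed d) : ∫ ω, mCh c x y ω ∂P = mG P c (y - x) := by
  unfold mG
  have h := integral_map (μ := P) (φ := τ x) (hτmp x).measurable.aemeasurable
    (f := mCh c 0 (y - x)) (mCh_meas hc _ _).aestronglyMeasurable
  rw [(hτmp x).map_eq] at h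
  rw [h]
  congr 1
  ext ω
  rw [mCh_stat hc, zero_add, sub_add_cancel]

lemma mG_lip {P : Measure Ω} [IsProbabilityMeasure P] (hc : IsCost τ C c)
    (hs : HasSub P c) (x y : Ed d) : mG P c x - mG P c y ≤ C * ‖x - y‖ := by
  unfold mG
  rw [← integral_sub (mCh_integrable hc hs _ _) (mCh_integrable hc hs _ _)]
  calc _ ≤ ∫ ω, (C * ‖x - y‖ : ℝ) ∂P := integral_mono
          ((mCh_integrable hc hs _ _).sub (mCh_integrable hc hs _ _)) (integrable_const _)
          fun ω => (le_abs_self _).trans (mCh_right hc 0 x y ω)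
    _ = _ := by simp

lemma mF_int {P : Measure Ω} [IsProbabilityMeasure P]
    (hτmp : ∀ y : Ed d, MeasurePreserving (τ y) P P)
    (hc : IsCost τ C c) (hs : HasSub P c) (e : Ed d) (N : ℕ) (v : Ed d) :
    ∫ ω, mF c e N v e ω ∂P = (N : ℝ)⁻¹ * (mG P c (-v) - mG P c (-v - (N : ℝ) • e)) := by
  unfold mF
  rw [integral_const_mul, integral_finsetSum]
  swap
  · exact fun i _ => (mCh_integrable hc hs _ _).sub (mCh_integrable hc hs _ _)
  congr 1
  have : ∀ i : ℕ, ∫ ω, (mCh c (v + ((i : ℝ) + 1) • e) e ω - mCh c (v + ((i : ℝ) + 1) • e) 0 ω) ∂P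
      = mG P c (-v - (i : ℝ) • e) - mG P c (-v - ((i + 1 : ℕ) : ℝ) • e) := by
    intro i
    rw [integral_sub (mCh_integrable hc hs _ _) (mCh_integrable hc hs _ _), mG_eq hτmp hc,
      mG_eq hτmp hc]
    congr 2
    · rw [add_smul, one_smul]; abel
    · push_cast; abel
  simp only [this]
  rw [Finset.sum_range_sub' (fun i : ℕ => mG P c (-v - (i : ℝ) • e))]
  simp

lemma mW_int {P : Measure Ω} [IsProbabilityMeasure P]
    (hτmp : ∀ y : Ed d, MeasurePreserving (τ y) P P)
    (hc : IsCost τ C c) (hs : HasSub P c) (e : Ed d) {N : ℕ} (hN : 0 < N) {R : ℝ} (hR : 0 < R) :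
    ∫ ω, mW c e N R e ω ∂P ≤ (N : ℝ)⁻¹ * (2 * C * R - mG P c (-((N : ℝ) • e))) := by
  unfold mW ballAvg
  have hNp : (0:ℝ) < N := by exact_mod_cast hN
  have hintW : Integrable (Function.uncurry fun (ω : Ω) (v : Ed d) => mF c e N v e ω)
      (P.prod (volume.restrict (Metric.ball (0 : Ed d) R))) := by
    have : IsFiniteMeasure (volume.restrict (Metric.ball (0 : Ed d) R)) :=
      ⟨by rw [Measure.restrict_apply_univ]; exact measure_ball_lt_top⟩
    refine Integrable.of_bound
      ((mF_meas2 hc e N e).comp measurable_swap).aestronglyMeasurable (C * ‖e‖)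
      (Eventually.of_forall fun q => ?_)
    have := mF_lip hc e hN q.2 e 0 q.1
    have h0 : mF c e N q.2 0 q.1 = 0 := by simp [mF]
    rw [h0, sub_zero, sub_zero] at this
    exact this
  rw [integral_const_mul, integral_integral_swap hintW]
  have hcont : Continuous fun v : Ed d => ∫ ω, mF c e N v e ω ∂P := by
    have hg : Continuous (mG P c) := by
      refine (lip_iff'.2 fun a b => ?_ : LipschitzWith C (mG P c)).continuous
      have h1 := mG_lip hc hs a b
      have h2 := mG_lip hc hs b a
      rw [norm_sub_rev] at h2
      rw [abs_le]; constructor <;> linarith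
    simp only [mF_int hτmp hc hs]
    exact continuous_const.mul ((hg.comp continuous_neg).sub
      (hg.comp (continuous_neg.sub continuous_const)))
  refine ballAvg_le hR hcont fun v hv => ?_
  rw [mF_int hτmp hc hs]
  refine mul_le_mul_of_nonneg_left ?_ (by positivity)
  have h1 := mG_lip hc hs (-v) 0
  have h2 := mG_lip hc hs (-((N : ℝ) • e)) (-v - (N : ℝ) • e)
  have h3 : mG P c 0 ≤ 0 := by
    unfold mG
    refine integral_nonpos_of_ae ?_
    filter_upwards [hs] with ω ⟨u, _, hu⟩
    have := mCh_abs hc hu 0 0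
    simp only [sub_self, norm_zero, mul_zero] at this
    exact (le_abs_self _).trans this
  have e1 : -((N : ℝ) • e) - (-v - (N : ℝ) • e) = v := by abel
  rw [e1] at h2
  rw [sub_zero, norm_neg] at h1
  have : (C:ℝ) * ‖v‖ ≤ C * R := mul_le_mul_of_nonneg_left hv C.2
  linarith

lemma slplus_bound {u : Ed d → ℝ} (hu : u ∈ SLplus d) {ε : ℝ} (hε : 0 < ε) :
    ∃ K : ℝ, ∀ y, -ε * ‖y‖ - K ≤ u y := by
  obtain ⟨⟨L, hL⟩, h⟩ := hu
  obtain ⟨R, hR⟩ := h ε hε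
  rw [lip_iff'] at hL
  refine ⟨|u 0| + L * |R|, fun y => ?_⟩
  have hLR : 0 ≤ (L:ℝ) * |R| := by positivity
  rcases eq_or_ne y 0 with rfl | hy
  · simp only [norm_zero, mul_zero]
    linarith [neg_abs_le (u 0)]
  have hyp : 0 < ‖y‖ := norm_pos_iff.2 hy
  by_cases hyR : R ≤ ‖y‖
  · have := hR y hyR
    rw [le_div_iff₀ hyp] at this
    linarith [abs_nonneg (u 0)]
  · have h1 := (abs_le.1 (hL y 0)).1
    rw [sub_zero] at h1
    have h2 : (L:ℝ) * ‖y‖ ≤ L * |R| :=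
      mul_le_mul_of_nonneg_left ((not_le.1 hyR).le.trans (le_abs_self R)) L.2
    have h3 : 0 ≤ ε * ‖y‖ := by positivity
    linarith [neg_abs_le (u 0)]

lemma mG_liminf {P : Measure Ω} [IsProbabilityMeasure P]
    (hc : IsCost τ C c) (hs : HasSub P c) (e : Ed d) {ε : ℝ} (hε : 0 < ε) :
    ∀ᶠ N : ℕ in atTop, -ε ≤ (N : ℝ)⁻¹ * mG P c (-((N : ℝ) • e)) := by
  have hbd : ∀ᵐ ω ∂P, ∀ N : ℕ, |(N : ℝ)⁻¹ * mCh c 0 (-((N : ℝ) • e)) ω| ≤ C * ‖e‖ := by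
    filter_upwards [hs] with ω ⟨u, _, hu⟩ N
    rcases Nat.eq_zero_or_pos N with rfl | hN
    · simp; positivity
    have hNp : (0:ℝ) < N := by exact_mod_cast hN
    rw [abs_mul, abs_of_pos (inv_pos.2 hNp), inv_mul_le_iff₀ hNp]
    refine (mCh_abs hc hu _ _).trans (le_of_eq ?_)
    rw [sub_zero, norm_neg, norm_smul, Real.norm_eq_abs, abs_of_pos hNp]; ring
  have hlim : Tendsto (fun N : ℕ => ∫ ω, min ((N : ℝ)⁻¹ * mCh c 0 (-((N : ℝ) • e)) ω) 0 ∂P)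
      atTop (𝓝 (∫ _, (0:ℝ) ∂P)) := by
    refine tendsto_integral_of_dominated_convergence (fun _ => (C * ‖e‖ : ℝ)) (fun N => ?_)
      (integrable_const _) (fun N => ?_) ?_
    · exact (((mCh_meas hc _ _).const_mul _).min measurable_const).aestronglyMeasurable
    · filter_upwards [hbd] with ω h
      have := abs_le.1 (h N)
      rw [Real.norm_eq_abs, abs_le]
      constructor
      · exact le_min this.1 (by have : 0 ≤ (C:ℝ) * ‖e‖ := by positivity
                                linarith)
      · exact (min_le_right _ _).trans (by positivity)
    · filter_upwards [hs] with ω ⟨u, huS, hu⟩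
      rw [Metric.tendsto_atTop]
      intro η hη
      obtain ⟨K, hK⟩ := slplus_bound huS (ε := η / (2 * (‖e‖ + 1))) (by positivity)
      obtain ⟨N0, hN0⟩ := exists_nat_gt (2 * (|K| + |u 0|) / η)
      refine ⟨N0 + 1, fun N hN => ?_⟩
      have hNp : (0:ℝ) < N := by exact_mod_cast (by omega : 0 < N)
      have hNN : (N0:ℝ) ≤ N := by exact_mod_cast (by omega : N0 ≤ N)
      rw [Real.dist_eq, sub_zero, abs_of_nonpos (min_le_right _ _), neg_lt]
      refine lt_min ?_ (by linarith)
      rw [lt_inv_mul_iff₀ hNp]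
      have h1 : u (-((N : ℝ) • e)) - u 0 ≤ mCh c 0 (-((N : ℝ) • e)) ω := chainInf_ge hu _ _
      have h2 := hK (-((N : ℝ) • e))
      rw [norm_neg, norm_smul, Real.norm_eq_abs, abs_of_pos hNp] at h2
      have h3 : η / (2 * (‖e‖ + 1)) * (N * ‖e‖) ≤ η / 2 * N := by
        have : ‖e‖ / (‖e‖ + 1) ≤ 1 := by
          rw [div_le_one (by positivity)]; linarith
        calc _ = η / 2 * N * (‖e‖ / (‖e‖ + 1)) := by field_simp
          _ ≤ η / 2 * N * 1 := by gcongr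
          _ = _ := by ring
      have h4 : 2 * (|K| + |u 0|) < N * η := by
        rw [div_lt_iff₀ hη] at hN0
        refine hN0.trans_le ?_
        gcongr
      linarith [le_abs_self K, le_abs_self (u 0)]
  rw [integral_zero] at hlim
  have hev := hlim.eventually (lt_mem_nhds (show -ε < 0 by linarith))
  filter_upwards [hev] with N hN
  refine hN.le.trans ?_
  unfold mG
  rw [← integral_const_mul]
  have hi := (mCh_integrable hc hs 0 (-((N : ℝ) • e))).const_mul (N : ℝ)⁻¹
  exact integral_mono (hi.inf (integrable_const 0)) hi fun ω => min_le_left _ _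

lemma slope_lemma (P : Measure Ω) [IsProbabilityMeasure P]
    (hτmp : ∀ y : Ed d, MeasurePreserving (τ y) P P)
    (hτgrp : ∀ x y : Ed d, τ (x + y) = τ x ∘ τ y) (hτzero : τ 0 = id)
    (hc : IsCost τ C c) (hs : HasSub P c) (e : Ed d) :
    ∃ w, StatProc τ C w ∧ SubC P c w ∧ ∫ ω, w e ω ∂P ≤ 0 := by
  have hN : ∀ k : ℕ, 0 < (k + 1) ^ 2 := fun k => by positivity
  have hR : ∀ k : ℕ, (0:ℝ) < (k:ℝ) + 1 := fun k => by positivity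
  have has : ∀ x z : Ed d, ∀ ε : ℝ, 0 < ε → ∃ N : ℕ, ∀ k ≥ N, ∀ ω,
      |mW c e ((k + 1) ^ 2) ((k:ℝ) + 1) x (τ z ω) - (mW c e ((k + 1) ^ 2) ((k:ℝ) + 1) (x + z) ω -
        mW c e ((k + 1) ^ 2) ((k:ℝ) + 1) z ω)| ≤ ε := by
    intro x z ε hε
    have t : Tendsto (fun k : ℕ => 2 * (C * ‖x‖) * ((1 + ‖z‖ * (1 / ((k:ℝ) + 1))) ^ d - 1)) atTop
        (𝓝 (2 * (C * ‖x‖) * ((1 + ‖z‖ * 0) ^ d - 1))) := by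
      have := (tendsto_one_div_add_atTop_nhds_zero_nat (𝕜 := ℝ)).const_mul ‖z‖
      exact (((this.const_add 1).pow d).sub_const 1).const_mul _
    simp only [mul_zero, add_zero, one_pow, sub_self] at t
    obtain ⟨N, hN'⟩ := eventually_atTop.1 (t.eventually (gt_mem_nhds hε))
    refine ⟨N, fun k hk ω => ?_⟩
    refine (mW_stat hc e (hN k) (hR k) x z ω).trans ?_
    have := (hN' k hk).le
    rwa [mul_one_div] at this
  obtain ⟨W, h1, h2, h3, -⟩ := limit_lemma P hτgrp hτzero (C := C)
    (w := fun k => mW c e ((k + 1) ^ 2) ((k:ℝ) + 1)) (fun k => mW_pre hc e (hN k) (hR k)) has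
  · refine ⟨W, h1, h2 c (Eventually.of_forall fun k => ?_), ?_⟩
    · filter_upwards [hs] with ω ⟨u, _, hu⟩ a b
      exact mW_sub hc e (hN k) (hR k) a b ω (chainGood_of_sub hu)
    · refine le_of_forall_pos_le_add fun ε hε => ?_
      rw [zero_add]
      refine h3 e ε ?_
      have t1 : Tendsto (fun k : ℕ => (k + 1) ^ 2) atTop atTop := by
        refine tendsto_atTop_mono (fun k => ?_) (tendsto_add_atTop_nat 1)
        nlinarith
      have e1 := t1.eventually (mG_liminf hc hs e (half_pos hε))
      have t2 : Tendsto (fun k : ℕ => 2 * (C:ℝ) * (1 / ((k:ℝ) + 1))) atTop (𝓝 (2 * C * 0)) :=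
        tendsto_one_div_add_atTop_nhds_zero_nat.const_mul _
      rw [mul_zero] at t2
      have e2 := t2.eventually (gt_mem_nhds (half_pos hε))
      filter_upwards [e1, e2] with k k1 k2
      refine (mW_int hτmp hc hs e (hN k) (hR k)).trans ?_
      rw [mul_sub]
      have : (((k + 1) ^ 2 : ℕ) : ℝ)⁻¹ * (2 * C * ((k:ℝ) + 1)) = 2 * (C:ℝ) * (1 / ((k:ℝ) + 1)) := by
        push_cast
        field_simp
      rw [this]
      linarith

end

/-! ### Existence of mean-zero subsolutions -/

section
variable {d : ℕ} {Ω : Type*} [MeasurableSpace Ω]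
variable {τ : Ed d → Ω → Ω} {C : ℝ≥0} {c : Ed d → Ed d → Ω → ℝ}

lemma StatProc.slope {w : Ed d → Ω → ℝ} (hw : StatProc τ C w) (P : Measure Ω)
    [IsProbabilityMeasure P] (hτmp : ∀ y : Ed d, MeasurePreserving (τ y) P P) :
    ∃ q : Ed d, ∀ x, ∫ ω, w x ω ∂P = ⟪q, x⟫ := by
  have hpre : PreProc C w := hw.toPreProc
  have hadd : ∀ x z, ∫ ω, w (x + z) ω ∂P = ∫ ω, w x ω ∂P + ∫ ω, w z ω ∂P := by
    intro x z
    have h := integral_map (μ := P) (φ := τ z) (hτmp z).measurable.aemeasurable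
      (f := w x) (hpre.meas x).aestronglyMeasurable
    rw [(hτmp z).map_eq] at h
    rw [h, ← integral_add]
    · congr 1; ext ω; rw [hw.stat]; ring
    · exact (hτmp z).integrable_comp_of_integrable (hpre.integrable P x)
    · exact hpre.integrable P z
  have hcont : Continuous fun x => ∫ ω, w x ω ∂P := by
    refine (lip_iff'.2 fun a b => ?_ : LipschitzWith C fun x => ∫ ω, w x ω ∂P).continuous
    rw [← integral_sub (hpre.integrable P a) (hpre.integrable P b)]
    have := norm_integral_le_of_norm_le_const (μ := P) (f := fun ω => w a ω - w b ω)
      (C := C * ‖a - b‖) (Eventually.of_forall fun ω => hpre.abs_sub_le a b ω)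
    simpa using this
  let f : Ed d →+ ℝ := AddMonoidHom.mk' (fun x => ∫ ω, w x ω ∂P) hadd
  let L : Ed d →L[ℝ] ℝ := f.toRealLinearMap hcont
  refine ⟨(InnerProductSpace.toDual ℝ (Ed d)).symm L, fun x => ?_⟩
  rw [InnerProductSpace.toDual_symm_apply]
  rfl

theorem exists_mean_zero (P : Measure Ω) [IsProbabilityMeasure P]
    (hτmp : ∀ y : Ed d, MeasurePreserving (τ y) P P)
    (hτgrp : ∀ x y : Ed d, τ (x + y) = τ x ∘ τ y) (hτzero : τ 0 = id)
    (hc : IsCost τ C c) (hs : HasSub P c) :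
    ∃ w, StatProc τ C w ∧ SubC P c w ∧ ∀ x, ∫ ω, w x ω ∂P = 0 := by
  set Q : Set (Ed d) := {q | ∃ w, StatProc τ C w ∧ SubC P c w ∧ ∀ x, ∫ ω, w x ω ∂P = ⟪q, x⟫}
    with hQ
  have hconv : Convex ℝ Q := by
    rintro q ⟨u, hu1, hu2, hu3⟩ r ⟨v, hv1, hv2, hv3⟩ a b ha hb hab
    refine ⟨a • u + b • v, ⟨convex_preProc C hu1.toPreProc hv1.toPreProc ha hb hab, ?_⟩,
      convex_subC P c hu2 hv2 ha hb hab, ?_⟩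
    · intro x z ω
      simp only [Pi.add_apply, Pi.smul_apply, smul_eq_mul, hu1.stat, hv1.stat]
      ring
    · intro x
      simp only [Pi.add_apply, Pi.smul_apply, smul_eq_mul]
      rw [integral_add ((hu1.toPreProc.integrable P x).const_mul a)
        ((hv1.toPreProc.integrable P x).const_mul b), integral_const_mul, integral_const_mul,
        hu3, hv3, inner_add_left, real_inner_smul_left, real_inner_smul_left]
  by_cases h0 : (0 : Ed d) ∈ closure Q
  · obtain ⟨q, hqQ, hq⟩ := mem_closure_iff_seq_limit.1 h0
    choose w hw1 hw2 hw3 using hqQ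
    obtain ⟨W, h1, h2, h3, h4⟩ := limit_lemma P hτgrp hτzero (C := C) (w := w)
      (fun k => (hw1 k).toPreProc) (fun x z ε hε => ⟨0, fun k _ ω => by
        rw [(hw1 k).stat, sub_self, abs_zero]; exact hε.le⟩)
    refine ⟨W, h1, h2 c (Eventually.of_forall hw2), fun x => ?_⟩
    have ht : Tendsto (fun k => ∫ ω, w k x ω ∂P) atTop (𝓝 0) := by
      simp only [hw3]
      have := hq.inner (tendsto_const_nhds (x := x)) (𝕜 := ℝ)
      simpa using this
    apply le_antisymm
    · refine le_of_forall_pos_le_add fun ε hε => ?_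
      rw [zero_add]
      refine h3 x ε ?_
      filter_upwards [ht.eventually (gt_mem_nhds hε)] with k hk using hk.le
    · refine le_of_forall_pos_le_add fun ε hε => ?_
      have := h4 x (-ε) (by
        filter_upwards [ht.eventually (lt_mem_nhds (show -ε < 0 by linarith))] with k hk using hk.le)
      linarith
  · exfalso
    obtain ⟨f, u, hf1, hf2⟩ := geometric_hahn_banach_point_closed hconv.closure isClosed_closure h0
    rw [map_zero] at hf1
    set e := (InnerProductSpace.toDual ℝ (Ed d)).symm f with he
    obtain ⟨w, hw1, hw2, hw3⟩ := slope_lemma P hτmp hτgrp hτzero hc hs e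
    obtain ⟨q, hq⟩ := hw1.slope P hτmp
    have := hf2 q (subset_closure ⟨w, hw1, hw2, hq⟩)
    have e1 : f q = ⟪e, q⟫ := by rw [he, InnerProductSpace.toDual_symm_apply]
    rw [hq, real_inner_comm, ← e1] at hw3
    linarith

end

/-! ### A mean value inequality for Lipschitz functions -/

section
variable {d : ℕ}

lemma lip_mean_value {u : Ed d → ℝ} {K : ℝ≥0} (hu : LipschitzWith K u) {a v : Ed d} (hv : v ≠ 0)
    {s : ℝ} (h : ∀ᵐ z : Ed d, ‖z - a‖ < 2 * ‖v‖ → ⟪gradient u z, v⟫ ≤ s) :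
    u (a + v) - u a ≤ s := by
  have hvp : 0 < ‖v‖ := norm_pos_iff.2 hv
  have hulip := lip_iff'.1 hu
  have hdiff : ∀ᵐ z : Ed d, DifferentiableAt ℝ u z := hu.ae_differentiableAt
  have key : ∀ r : ℝ, 0 < r → r ≤ ‖v‖ → u (a + v) - u a ≤ s + 2 * K * r := by
    intro r hr hrv
    set B := Metric.ball a r with hB
    set V : ℝ := volume.real B with hV
    have hVp : 0 < V :=
      ENNReal.toReal_pos (Metric.measure_ball_pos volume a hr).ne' measure_ball_lt_top.ne
    have hfin : IsFiniteMeasure (volume.restrict B) :=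
      ⟨by rw [Measure.restrict_apply_univ]; exact measure_ball_lt_top⟩
    have hcont : ∀ t : ℝ, Continuous fun z => u (z + t • v) := fun t =>
      hu.continuous.comp (continuous_id.add continuous_const)
    have hder : ∀ t : ℝ, Integrable (fun z => fderiv ℝ u (z + t • v) v) (volume.restrict B) ∧
        HasDerivAt (fun t => ∫ z in B, u (z + t • v)) (∫ z in B, fderiv ℝ u (z + t • v) v) t := by
      intro t
      refine hasDerivAt_integral_of_dominated_loc_of_lip (bound := fun _ => K * ‖v‖)
        (s := Set.univ) Filter.univ_mem
        (Eventually.of_forall fun t => (hcont t).aestronglyMeasurable) (intOn_ball (hcont t) _ _)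
        ?_ ?_ (integrable_const _) ?_
      · exact ((measurable_fderiv_apply_const ℝ u v).comp
          (measurable_id.add_const _)).aestronglyMeasurable
      · refine Eventually.of_forall fun z => LipschitzWith.lipschitzOnWith ?_
        rw [lipschitzWith_iff_dist_le_mul]
        intro x y
        simp only [Real.dist_eq, Real.coe_nnabs]
        refine (hulip _ _).trans (le_of_eq ?_)
        rw [abs_of_nonneg (by positivity), add_sub_add_left_eq_sub, ← sub_smul, norm_smul,
          Real.norm_eq_abs]
        ring
      · have := (measurePreserving_add_right (volume : Measure (Ed d))
          (t • v)).quasiMeasurePreserving.ae hdiff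
        filter_upwards [ae_restrict_of_ae this] with z hz
        have h1 : HasDerivAt (fun t : ℝ => z + t • v) v t := by
          simpa using ((hasDerivAt_id t).smul_const v).const_add z
        exact hz.hasFDerivAt.comp_hasDerivAt t h1
    have hle : ∀ t ∈ Set.Icc (0:ℝ) 1, ∫ z in B, fderiv ℝ u (z + t • v) v ≤ s * V := by
      intro t ht
      have := (measurePreserving_add_right (volume : Measure (Ed d))
          (t • v)).quasiMeasurePreserving.ae h
      have h2 : ∫ z in B, fderiv ℝ u (z + t • v) v ≤ ∫ z in B, s := by
        refine integral_mono_ae (hder t).1 (integrable_const _) ?_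
        rw [EventuallyLE, ae_restrict_iff' measurableSet_ball]
        filter_upwards [this] with z hz hzB
        rw [← inner_gradient_left]
        apply hz
        have hzr : ‖z - a‖ < r := by simpa [hB, dist_eq_norm] using hzB
        calc ‖z + t • v - a‖ = ‖(z - a) + t • v‖ := by congr 1; abel
          _ ≤ ‖z - a‖ + ‖t • v‖ := norm_add_le _ _
          _ = ‖z - a‖ + t * ‖v‖ := by rw [norm_smul, Real.norm_eq_abs, abs_of_nonneg ht.1]
          _ < 2 * ‖v‖ := by nlinarith [ht.2]
      rw [setIntegral_const, smul_eq_mul] at h2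
      linarith
    have hmv := (convex_Icc (0:ℝ) 1).image_sub_le_mul_sub_of_deriv_le
      (f := fun t => ∫ z in B, u (z + t • v)) (C := s * V)
      (fun t _ => (hder t).2.continuousAt.continuousWithinAt)
      (fun t _ => (hder t).2.differentiableAt.differentiableWithinAt)
      (fun t ht => by rw [(hder t).2.deriv]; exact hle t (interior_subset ht))
      0 (by simp) 1 (by simp) zero_le_one
    simp only [one_smul, zero_smul, add_zero, sub_zero, mul_one] at hmv
    have i1 : IntegrableOn (fun z => u (z + v)) B := by simpa using intOn_ball (hcont 1) a r
    have i2 : IntegrableOn (fun z => u z) B := intOn_ball hu.continuous a r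
    rw [← integral_sub i1 i2] at hmv
    have hlow : ∫ z in B, (u (a + v) - u a - 2 * K * r) ≤ ∫ z in B, (u (z + v) - u z) := by
      refine setIntegral_mono_on (integrable_const _) (i1.sub i2) measurableSet_ball fun z hz => ?_
      have hzr : ‖a - z‖ < r := by simpa [hB, dist_eq_norm, norm_sub_rev] using hz
      have h1 := (abs_le.1 (hulip (a + v) (z + v))).2
      have h2 := (abs_le.1 (hulip a z)).1
      rw [add_sub_add_right_eq_sub] at h1
      have h3 : (K:ℝ) * ‖a - z‖ ≤ K * r := mul_le_mul_of_nonneg_left hzr.le K.2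
      linarith
    rw [setIntegral_const, smul_eq_mul] at hlow
    have : V * (u (a + v) - u a - 2 * K * r) ≤ V * s := by
      calc _ ≤ _ := hlow
        _ ≤ _ := hmv
        _ = _ := mul_comm _ _
    have := le_of_mul_le_mul_left this hVp
    linarith
  refine le_of_forall_pos_le_add fun ε hε => ?_
  have := key (min ‖v‖ (ε / (2 * K + 1))) (by positivity) (min_le_left _ _)
  refine this.trans ?_
  have h1 : 2 * (K:ℝ) * min ‖v‖ (ε / (2 * K + 1)) ≤ 2 * K * (ε / (2 * K + 1)) := by
    gcongr; exact min_le_right _ _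
  have h2 : 2 * (K:ℝ) * (ε / (2 * K + 1)) ≤ ε := by
    rw [mul_div_assoc', div_le_iff₀ (by positivity)]
    nlinarith [K.2]
  linarith

/-- Penalised support functional. -/
def costF (h : Ed d → Ed d → ℝ) (μ m M : ℝ) (a b q : Ed d) : ℝ :=
  ⟪q, b - a⟫ - m * ‖b - a‖ * max 0 (h q a - μ - 2 / m - M * ‖b - a‖)

/-- The local cost. -/
def cost (h : Ed d → Ed d → ℝ) (μ m M C : ℝ) (a b : Ed d) : ℝ :=
  sSup (costF h μ m M a b '' Metric.closedBall 0 C)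

variable {h : Ed d → Ed d → ℝ} {μ m M C : ℝ}

lemma costF_cont (hh : Continuous fun q : Ed d × Ed d => h q.1 q.2) :
    Continuous fun z : (Ed d × Ed d) × Ed d => costF h μ m M z.1.1 z.1.2 z.2 := by
  unfold costF
  have h1 : Continuous fun z : (Ed d × Ed d) × Ed d => h z.2 z.1.1 :=
    hh.comp (continuous_snd.prodMk continuous_fst.fst)
  fun_prop

lemma cost_cont (hh : Continuous fun q : Ed d × Ed d => h q.1 q.2) :
    Continuous fun q : Ed d × Ed d => cost h μ m M C q.1 q.2 :=
  (isCompact_closedBall (0 : Ed d) C).continuous_sSup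
    (f := fun (ab : Ed d × Ed d) q => costF h μ m M ab.1 ab.2 q) (costF_cont hh)

lemma costF_contq (hh : Continuous fun q : Ed d × Ed d => h q.1 q.2) (a b : Ed d) :
    Continuous (costF h μ m M a b) :=
  (costF_cont hh).comp (continuous_const.prodMk continuous_id : Continuous fun q => ((a, b), q))

lemma costF_bdd (hh : Continuous fun q : Ed d × Ed d => h q.1 q.2) (a b : Ed d) :
    BddAbove (costF h μ m M a b '' Metric.closedBall 0 C) :=
  ((isCompact_closedBall (0 : Ed d) C).image (costF_contq hh a b)).bddAbove

lemma costF_le_cost (hh : Continuous fun q : Ed d × Ed d => h q.1 q.2) (a b : Ed d) {q : Ed d}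
    (hq : ‖q‖ ≤ C) : costF h μ m M a b q ≤ cost h μ m M C a b :=
  le_csSup (costF_bdd hh a b) ⟨q, by simpa using hq, rfl⟩

lemma cost_attained (hC : 0 ≤ C) (hh : Continuous fun q : Ed d × Ed d => h q.1 q.2) (a b : Ed d) :
    ∃ q : Ed d, ‖q‖ ≤ C ∧ cost h μ m M C a b = costF h μ m M a b q := by
  obtain ⟨q, hq, he⟩ := (isCompact_closedBall (0 : Ed d) C).exists_sSup_image_eq
    ⟨0, by simpa using hC⟩ (costF_contq (μ := μ) (m := m) (M := M) hh a b).continuousOn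
  exact ⟨q, by simpa using hq, he⟩

lemma cost_le (hC : 0 ≤ C) (hm : 0 ≤ m) (hh : Continuous fun q : Ed d × Ed d => h q.1 q.2)
    (a b : Ed d) : cost h μ m M C a b ≤ C * ‖b - a‖ := by
  obtain ⟨q, hq, he⟩ := cost_attained (μ := μ) (m := m) (M := M) hC hh a b
  rw [he, costF]
  have h1 : ⟪q, b - a⟫ ≤ C * ‖b - a‖ := (real_inner_le_norm _ _).trans (by gcongr)
  have h2 : 0 ≤ m * ‖b - a‖ * max 0 (h q a - μ - 2 / m - M * ‖b - a‖) :=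
    mul_nonneg (by positivity) (le_max_left _ _)
  linarith

/-- Almost everywhere subsolutions have increments dominated by the cost. -/
lemma sub_cost {u : Ed d → ℝ} {K : ℝ≥0} (hu : LipschitzWith K u) (hC : 0 ≤ C)
    (hh : Continuous fun q : Ed d × Ed d => h q.1 q.2)
    (hae : ∀ᵐ z : Ed d, h (gradient u z) z ≤ μ + 1 / m)
    (hcoer : ∀ q z : Ed d, h q z ≤ μ + 1 / m → ‖q‖ ≤ C)
    (hmod : ∀ q z a v : Ed d, ‖q‖ ≤ C → ‖z - a‖ < 2 * ‖v‖ → h q a ≤ h q z + 1 / m + M * ‖v‖)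
    (a b : Ed d) : u b - u a ≤ cost h μ m M C a b := by
  rcases eq_or_ne b a with rfl | hba
  · rw [sub_self]
    have := costF_le_cost (μ := μ) (m := m) (M := M) hh b b (q := 0) (C := C) (by simpa using hC)
    simpa [costF] using this
  have hv : b - a ≠ 0 := sub_ne_zero.2 hba
  have := lip_mean_value hu (a := a) hv (s := cost h μ m M C a b) (by
    filter_upwards [hae] with z hz hza
    have hq := hcoer _ _ hz
    refine le_trans (le_of_eq ?_) (costF_le_cost hh a b hq)
    have h1 := hmod _ z a (b - a) hq hza
    have h2 : (2:ℝ) / m = 1 / m + 1 / m := by ring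
    rw [costF, max_eq_left (by linarith)]
    ring)
  rwa [add_sub_cancel] at this

/-- Midpoint closed compact sets: variational inequality for the projection. -/
lemma midpoint_proj {S : Set (Ed d)} (hS : IsCompact S) (hne : S.Nonempty)
    (hmid : ∀ x ∈ S, ∀ y ∈ S, (1 / 2 : ℝ) • (x + y) ∈ S) (g : Ed d) :
    ∃ q₀ ∈ S, ∀ q ∈ S, ⟪q - q₀, g - q₀⟫ ≤ 0 := by
  obtain ⟨q₀, hq₀, hmin⟩ := hS.exists_isMinOn hne
    (f := fun q => ‖g - q‖) (by fun_prop)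
  refine ⟨q₀, hq₀, fun q hq => ?_⟩
  have hpow : ∀ n : ℕ, q₀ + ((1 / 2 : ℝ) ^ n) • (q - q₀) ∈ S := by
    intro n
    induction n with
    | zero => simpa using hq
    | succ n ih =>
      have := hmid _ hq₀ _ ih
      convert this using 1
      rw [pow_succ, mul_comm, mul_smul, smul_add, smul_add, ← add_assoc]
      congr 1
      rw [← add_smul]; norm_num
  have hineq : ∀ n : ℕ, 2 * ⟪q - q₀, g - q₀⟫ ≤ (1 / 2 : ℝ) ^ n * ‖q - q₀‖ ^ 2 := by
    intro n
    have h1 : ‖g - q₀‖ ≤ ‖g - (q₀ + ((1 / 2 : ℝ) ^ n) • (q - q₀))‖ := hmin (hpow n)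
    have h2 : g - (q₀ + ((1 / 2 : ℝ) ^ n) • (q - q₀)) = (g - q₀) - ((1 / 2 : ℝ) ^ n) • (q - q₀) := by
      abel
    have h3 := pow_le_pow_left₀ (norm_nonneg _) h1 2
    rw [h2, norm_sub_sq_real (g - q₀), real_inner_smul_right, norm_smul, Real.norm_eq_abs,
      abs_of_pos (by positivity), real_inner_comm, mul_pow] at h3
    have hp : (0:ℝ) < (1 / 2 : ℝ) ^ n := by positivity
    have h4 : (1 / 2 : ℝ) ^ n * (2 * ⟪q - q₀, g - q₀⟫) ≤
        (1 / 2 : ℝ) ^ n * ((1 / 2 : ℝ) ^ n * ‖q - q₀‖ ^ 2) := by nlinarith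
    exact le_of_mul_le_mul_left h4 hp
  have ht : Tendsto (fun n : ℕ => (1 / 2 : ℝ) ^ n * ‖q - q₀‖ ^ 2) atTop (𝓝 (0 * ‖q - q₀‖ ^ 2)) :=
    (tendsto_pow_atTop_nhds_zero_of_lt_one (by norm_num) (by norm_num)).mul_const _
  rw [zero_mul] at ht
  have := ge_of_tendsto' ht hineq
  linarith

end

/-! ### From increments back to gradients -/

section
variable {d : ℕ} {h : Ed d → Ed d → ℝ} {μ C : ℝ} {M : ℕ → ℝ}

lemma cost_dir (hC : 0 ≤ C) (hh : Continuous fun q : Ed d × Ed d => h q.1 q.2)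
    {u : Ed d → ℝ} {a : Ed d} (hu : DifferentiableAt ℝ u a)
    (hsub : ∀ (n : ℕ) b, u b - u a ≤ cost h μ ((n : ℝ) + 1) (M n) C a b) {e : Ed d} (he : e ≠ 0)
    {η : ℝ} (hη : 0 < η) :
    ∃ q : Ed d, ‖q‖ ≤ C ∧ ⟪gradient u a, e⟫ - η ≤ ⟪q, e⟫ ∧ h q a ≤ μ + η := by
  set g := gradient u a with hg
  have hE : 0 < ‖e‖ := norm_pos_iff.2 he
  obtain ⟨n, hn⟩ := exists_nat_gt ((C + ‖g‖ + 3) / (η / 2))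
  set m : ℝ := (n : ℝ) + 1 with hm
  have hmp : 0 < m := by positivity
  have hn' : (C + ‖g‖ + 3) / m ≤ η / 2 := by
    rw [div_lt_iff₀ (by positivity)] at hn
    rw [div_le_iff₀ hmp]
    nlinarith
  have hder : HasDerivAt (fun t : ℝ => u (a + t • e)) ⟪g, e⟫ 0 := by
    have h1 : HasDerivAt (fun t : ℝ => a + t • e) e 0 := by
      simpa using ((hasDerivAt_id (0:ℝ)).smul_const e).const_add a
    have h2 : HasFDerivAt u (fderiv ℝ u a) (a + (0:ℝ) • e) := by
      simpa using hu.hasFDerivAt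
    have := h2.comp_hasDerivAt (0:ℝ) h1
    rw [hg, inner_gradient_left]
    exact this
  have hslope := hder.tendsto_slope_zero_right
  simp only [zero_add, zero_smul, add_zero, smul_eq_mul] at hslope
  have hη' : 0 < min η ‖e‖ := lt_min hη hE
  have ev1 := hslope.eventually (lt_mem_nhds (show ⟪g, e⟫ - min η ‖e‖ < ⟪g, e⟫ by linarith))
  have ht : Tendsto (fun t : ℝ => M n * (t * ‖e‖)) (𝓝[>] 0) (𝓝 (M n * (0 * ‖e‖))) :=
    (Continuous.tendsto (by fun_prop) 0).mono_left nhdsWithin_le_nhds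
  rw [zero_mul, mul_zero] at ht
  have ev2 := ht.eventually (gt_mem_nhds (half_pos hη))
  obtain ⟨t, ⟨ht1, ht2⟩, ht3⟩ := ((ev1.and ev2).and self_mem_nhdsWithin).exists
  have htp : (0:ℝ) < t := ht3
  obtain ⟨q, hq, hqe⟩ := cost_attained (μ := μ) (m := m) (M := M n) hC hh a (a + t • e)
  have h1 := hsub n (a + t • e)
  rw [hqe, costF, add_sub_cancel_left, real_inner_smul_right, norm_smul, Real.norm_eq_abs,
    abs_of_pos htp] at h1
  set X := max 0 (h q a - μ - 2 / m - M n * (t * ‖e‖)) with hX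
  have hX0 : 0 ≤ X := le_max_left _ _
  have hX1 : h q a - μ - 2 / m - M n * (t * ‖e‖) ≤ X := le_max_right _ _
  rw [lt_inv_mul_iff₀ htp] at ht1
  have h2 : ⟪g, e⟫ - min η ‖e‖ < ⟪q, e⟫ - m * ‖e‖ * X := by
    have : t * (⟪g, e⟫ - min η ‖e‖) < t * (⟪q, e⟫ - m * ‖e‖ * X) := by
      refine ht1.trans_le (h1.trans (le_of_eq ?_)); ring
    exact lt_of_mul_lt_mul_left this htp.le
  have hpos : 0 ≤ m * ‖e‖ * X := by positivity
  refine ⟨q, hq, by linarith [min_le_left η ‖e‖], ?_⟩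
  have h3 : ⟪q, e⟫ ≤ C * ‖e‖ := (real_inner_le_norm _ _).trans (by gcongr)
  have h4 : -(‖g‖ * ‖e‖) ≤ ⟪g, e⟫ := (abs_le.1 (abs_real_inner_le_norm g e)).1
  have h5 : ‖e‖ * (m * X) ≤ ‖e‖ * (C + ‖g‖ + 1) := by
    nlinarith [min_le_right η ‖e‖]
  have h6 := le_of_mul_le_mul_left h5 hE
  have h7 : X ≤ (C + ‖g‖ + 1) / m := by rw [le_div_iff₀ hmp]; linarith
  have h8 : (C + ‖g‖ + 3) / m = (C + ‖g‖ + 1) / m + 2 / m := by ring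
  linarith

lemma cost_grad (hd : 0 < d) (hC : 0 ≤ C) (hh : Continuous fun q : Ed d × Ed d => h q.1 q.2)
    (hqc : ∀ x y a, h ((1 / 2 : ℝ) • (x + y)) a ≤ max (h x a) (h y a))
    {u : Ed d → ℝ} {a : Ed d} (hu : DifferentiableAt ℝ u a)
    (hsub : ∀ (n : ℕ) b, u b - u a ≤ cost h μ ((n : ℝ) + 1) (M n) C a b) :
    h (gradient u a) a ≤ μ := by
  refine le_of_forall_pos_le_add fun η hη => ?_
  set g := gradient u a with hg
  set S : Set (Ed d) := {q | h q a ≤ μ + η} ∩ Metric.closedBall 0 C with hS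
  have hcl : IsClosed {q | h q a ≤ μ + η} :=
    isClosed_le (hh.comp (continuous_id.prodMk continuous_const)) continuous_const
  have hcomp : IsCompact S := (isCompact_closedBall _ _).inter_left hcl
  have hex : ∃ e : Ed d, e ≠ 0 :=
    ⟨EuclideanSpace.single ⟨0, hd⟩ 1, by simp⟩
  obtain ⟨e0, he0⟩ := hex
  obtain ⟨q1, hq1, -, hq1'⟩ := cost_dir hC hh hu hsub he0 hη
  obtain ⟨q₀, hq₀, hproj⟩ := midpoint_proj hcomp ⟨q1, hq1', by simpa using hq1⟩ (by
    rintro x ⟨hx1, hx2⟩ y ⟨hy1, hy2⟩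
    refine ⟨(hqc x y a).trans (max_le hx1 hy1), ?_⟩
    have := (convex_closedBall (0 : Ed d) C) hx2 hy2 (by norm_num : (0:ℝ) ≤ 1 / 2)
      (by norm_num : (0:ℝ) ≤ 1 / 2) (by norm_num)
    rwa [← smul_add] at this) g
  by_cases hgq : g = q₀
  · rw [hgq]; exact hq₀.1
  · exfalso
    have he : g - q₀ ≠ 0 := sub_ne_zero.2 hgq
    have hep : 0 < ‖g - q₀‖ ^ 2 := by have := norm_pos_iff.2 he; positivity
    obtain ⟨q, hq, hq2, hq3⟩ := cost_dir hC hh hu hsub he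
      (lt_min hη (half_pos hep))
    have h1 := hproj q ⟨hq3.trans (by linarith [min_le_left η (‖g - q₀‖ ^ 2 / 2)]),
      by simpa using hq⟩
    have h2 : ⟪g - q₀, g - q₀⟫ = ‖g - q₀‖ ^ 2 := real_inner_self_eq_norm_sq _
    rw [inner_sub_left] at h1 h2
    linarith [min_le_right η (‖g - q₀‖ ^ 2 / 2)]

end

section
variable {d : ℕ} {Ω : Type*} [MeasurableSpace Ω] {τ : Ed d → Ω → Ω}

lemma cost_isCost {h : Ed d → Ed d → Ω → ℝ} {μ m M : ℝ} {C : ℝ≥0} (hm : 0 ≤ m)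
    (hmeas : ∀ q a, Measurable (h q a))
    (hcont : ∀ ω, Continuous fun q : Ed d × Ed d => h q.1 q.2 ω)
    (hstat : ∀ q a z ω, h q a (τ z ω) = h q (a + z) ω) :
    IsCost τ C (fun a b ω => cost (fun q x => h q x ω) μ m M C a b) := by
  refine ⟨fun a b => ?_, fun ω => cost_cont (hcont ω), fun a b ω => cost_le C.2 hm (hcont ω) a b,
    fun a b z ω => ?_⟩
  · refine measurable_of_Iic fun t => ?_
    have hne : Nonempty (Metric.closedBall (0 : Ed d) C) := ⟨⟨0, by simp⟩⟩
    set xs : ℕ → Metric.closedBall (0 : Ed d) C := TopologicalSpace.denseSeq _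
    have hxs : DenseRange xs := TopologicalSpace.denseRange_denseSeq _
    have heq : (fun ω => cost (fun q x => h q x ω) μ m M C a b) ⁻¹' Set.Iic t =
        ⋂ k, {ω | costF (fun q x => h q x ω) μ m M a b (xs k) ≤ t} := by
      ext ω
      simp only [Set.mem_preimage, Set.mem_Iic, Set.mem_iInter, Set.mem_ofPred_eq]
      constructor
      · intro hle k
        exact (costF_le_cost (hcont ω) a b (mem_closedBall_zero_iff.1 (xs k).2)).trans hle
      · intro hk
        have hall : ∀ q : Metric.closedBall (0 : Ed d) C,
            costF (fun q x => h q x ω) μ m M a b q ≤ t := by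
          intro q
          refine hxs.induction_on (p := fun q : Metric.closedBall (0 : Ed d) C =>
            costF (fun q x => h q x ω) μ m M a b q ≤ t) q ?_ hk
          exact isClosed_le ((costF_contq (hcont ω) a b).comp continuous_subtype_val)
            continuous_const
        obtain ⟨q, hq, he⟩ := cost_attained (h := fun q x => h q x ω) (μ := μ) (m := m)
          (M := M) C.coe_nonneg (hcont ω) a b
        rw [he]
        exact hall ⟨q, by simpa using hq⟩
    rw [heq]
    refine MeasurableSet.iInter fun k => measurableSet_le ?_ measurable_const
    unfold costF
    refine Measurable.const_sub (Measurable.const_mul ?_ _) _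
    exact measurable_const.max ((((hmeas _ _).sub_const _).sub_const _).sub_const _)
  · simp only [cost]
    have : costF (fun q x => h q x (τ z ω)) μ m M a b =
        costF (fun q x => h q x ω) μ m M (a + z) (b + z) := by
      ext q
      simp only [costF, hstat, add_sub_add_right_eq_sub]
    rw [this]

lemma IsCost.min {C : ℝ≥0} {c c' : Ed d → Ed d → Ω → ℝ} (hc : IsCost τ C c)
    (hc' : IsCost τ C c') : IsCost τ C (fun a b ω => Min.min (c a b ω) (c' a b ω)) :=
  ⟨fun a b => (hc.meas a b).min (hc'.meas a b), fun ω => (hc.cont ω).min (hc'.cont ω),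
    fun a b ω => (min_le_left _ _).trans (hc.le a b ω),
    fun a b z ω => by rw [hc.stat, hc'.stat]⟩

/-- Running minimum of costs. -/
def minCost (c : ℕ → Ed d → Ed d → Ω → ℝ) : ℕ → Ed d → Ed d → Ω → ℝ
  | 0 => c 0
  | n + 1 => fun a b ω => min (minCost c n a b ω) (c (n + 1) a b ω)

lemma minCost_isCost {C : ℝ≥0} {c : ℕ → Ed d → Ed d → Ω → ℝ} (hc : ∀ n, IsCost τ C (c n))
    (n : ℕ) : IsCost τ C (minCost c n) := by
  induction n with
  | zero => exact hc 0
  | succ n ih => exact ih.min (hc (n + 1))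

lemma minCost_le {c : ℕ → Ed d → Ed d → Ω → ℝ} {j n : ℕ} (hj : j ≤ n) (a b : Ed d) (ω : Ω) :
    minCost c n a b ω ≤ c j a b ω := by
  induction n with
  | zero => obtain rfl : j = 0 := by omega
            exact le_rfl
  | succ n ih =>
    rcases Nat.lt_or_ge n j with h | h
    · obtain rfl : j = n + 1 := by omega
      exact min_le_right _ _
    · exact (min_le_left _ _).trans (ih h)

lemma le_minCost {c : ℕ → Ed d → Ed d → Ω → ℝ} {n : ℕ} {a b : Ed d} {ω : Ω} {s : ℝ}
    (h : ∀ j ≤ n, s ≤ c j a b ω) : s ≤ minCost c n a b ω := by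
  induction n with
  | zero => exact h 0 le_rfl
  | succ n ih => exact le_min (ih fun j hj => h j (by omega)) (h (n + 1) le_rfl)

end

/-! ### Essential suprema and the main theorem -/

lemma grad_norm_le {d : ℕ} {w : Ed d → ℝ} {K : ℝ≥0} (hw : LipschitzWith K w) (y : Ed d) :
    ‖gradient w y‖ ≤ K := by
  rw [gradient, LinearIsometryEquiv.norm_map]
  exact norm_fderiv_le_of_lipschitz ℝ hw

lemma le_essSup_of_bdd {d : ℕ} {f : Ed d → ℝ} {B : ℝ} (hf : ∀ y, |f y| ≤ B) :
    ∀ᵐ y : Ed d, f y ≤ essSup f volume :=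
  ae_le_essSup (isBoundedUnder_of ⟨B, fun y => (abs_le.1 (hf y)).2⟩)

lemma essSup_le_of_bdd {d : ℕ} {f : Ed d → ℝ} {B t : ℝ} (hf : ∀ y, |f y| ≤ B)
    (h : ∀ᵐ y : Ed d, f y ≤ t) : essSup f volume ≤ t :=
  limsup_le_of_le (isCoboundedUnder_le_of_le _ fun y => (abs_le.1 (hf y)).1) h

/-- inf-sup formula over 𝓢 and existence of exact subcorrectors. -/
theorem statement_19
    (d : ℕ) (hd : 0 < d)
    {Ω : Type*} [MeasurableSpace Ω] (P : Measure Ω) [IsProbabilityMeasure P]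
    (τ : Ed d → Ω → Ω)
    (hτmeas : ∀ y : Ed d, Measurable (τ y))
    (hτmp : ∀ y : Ed d, MeasurePreserving (τ y) P P)
    (hτgrp : ∀ x y : Ed d, τ (x + y) = τ x ∘ τ y)
    (hτzero : τ 0 = id)
    (hτerg : ∀ A : Set Ω, MeasurableSet A → (∀ z : Ed d, τ z ⁻¹' A = A) → P A = 0 ∨ P A = 1)
    (H : Ed d → Ed d → Ω → ℝ)
    (hHmeas : Measurable fun x : Ed d × Ed d × Ω => H x.1 x.2.1 x.2.2)
    (hHstat : ∀ (p y z : Ed d) (ω : Ω), H p y (τ z ω) = H p (y + z) ω)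
    (hHcont : ∀ ω : Ω, Continuous fun q : Ed d × Ed d => H q.1 q.2 ω)
    (hreg_bdd : ∀ R : ℝ, 0 < R → ∃ M : ℝ, ∀ (ω : Ω) (p y : Ed d), ‖p‖ ≤ R → |H p y ω| ≤ M)
    (hreg_uc : ∀ R : ℝ, 0 < R → ∀ ε : ℝ, 0 < ε → ∃ δ : ℝ, 0 < δ ∧ ∀ (ω : Ω) (p p' y y' : Ed d),
      ‖p‖ ≤ R → ‖p'‖ ≤ R → ‖p - p'‖ < δ → ‖y - y'‖ < δ → |H p y ω - H p' y' ω| < ε)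
    (hcoer : ∀ M : ℝ, ∃ R : ℝ, ∀ (ω : Ω) (p y : Ed d), R ≤ ‖p‖ → M ≤ H p y ω)
    (hqc : ∀ (ω : Ω) (p q y : Ed d), H ((1/2 : ℝ) • (p + q)) y ω ≤ max (H p y ω) (H q y ω))
    (Λ : ℝ → ℝ → ℝ)
    (hΛcont : Continuous fun m : ℝ × ℝ => Λ m.1 m.2)
    (hΛmono : ∀ a b a' b' : ℝ, a ≤ a' → b ≤ b' → Λ a b ≤ Λ a' b')
    (hΛstrict : ∀ a b : ℝ, a ≠ b → Λ a b < max a b)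
    (hsqc : ∀ (ω : Ω) (p q y : Ed d), H ((1/2 : ℝ) • (p + q)) y ω ≤ Λ (H p y ω) (H q y ω))
    (HbarP HbarM : Ed d → ℝ)
    (hHbarP : ∀ p : Ed d, ∀ᵐ ω ∂P, HbarPlusOm d H p ω = HbarP p)
    (hHbarM : ∀ p : Ed d, ∀ᵐ ω ∂P, HbarMinusOm d H p ω = HbarM p)
    (hPM : ∀ p : Ed d, HbarP p = HbarM p) :
    ∀ p : Ed d,
      (∀ᵐ ω ∂P, HhatOm d H p ω = HbarP p) ∧
      ∃ w : Ed d → Ω → ℝ,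
        (Measurable fun x : Ed d × Ω => w x.1 x.2) ∧
        (∃ C : ℝ≥0, ∀ ω : Ω, LipschitzWith C (fun y => w y ω)) ∧
        (∀ (x y z : Ed d) (ω : Ω),
          w x (τ z ω) - w y (τ z ω) = w (x + z) ω - w (y + z) ω) ∧
        (∀ x : Ed d, ∫ ω, (w x ω - w 0 ω) ∂P = 0) ∧
        (∀ᵐ ω ∂P,
          (∀ᵐ y ∂(volume : Measure (Ed d)),
            H (p + gradient (fun y' => w y' ω) y) y ω ≤ HbarP p) ∧
          Tendsto (fun y : Ed d => w y ω / ‖y‖) (cobounded (Ed d)) (𝓝 0)) := by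
  intro p
  set μ := HbarP p with hμ
  -- global bounds
  have hgrad : ∀ {w : Ed d → ℝ} {K : ℝ≥0}, LipschitzWith K w → ∀ y, ‖gradient w y‖ ≤ K :=
    fun hw y => grad_norm_le hw y
  have hbd : ∀ w ∈ LipFuns d, ∃ B : ℝ, ∀ ω y, |H (p + gradient w y) y ω| ≤ B := by
    rintro w ⟨K, hK⟩
    obtain ⟨B, hB⟩ := hreg_bdd (‖p‖ + K + 1) (by positivity)
    refine ⟨B, fun ω y => hB ω _ y ?_⟩
    linarith [norm_add_le p (gradient w y), hgrad hK y]
  obtain ⟨M0, hM0⟩ : ∃ M0 : ℝ, ∀ (ω : Ω) (q y : Ed d), M0 ≤ H q y ω := by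
    obtain ⟨R, hR⟩ := hcoer 0
    obtain ⟨B, hB⟩ := hreg_bdd (|R| + 1) (by positivity)
    refine ⟨min 0 (-B), fun ω q y => ?_⟩
    by_cases h : R ≤ ‖q‖
    · exact (min_le_left _ _).trans (hR ω q y h)
    · refine (min_le_right _ _).trans (abs_le.1 (hB ω q y ?_)).1
      linarith [le_abs_self R, not_le.1 h]
  have hlow : ∀ w ∈ LipFuns d, ∀ ω, M0 ≤ essSup (fun y => H (p + gradient w y) y ω) volume := by
    intro w hw ω
    obtain ⟨B, hB⟩ := hbd w hw
    obtain ⟨y, hy⟩ := (le_essSup_of_bdd (hB ω)).exists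
    exact (hM0 ω _ y).trans hy
  have hzero : (fun _ : Ed d => (0:ℝ)) ∈ Scal d := by
    have hl : (fun _ : Ed d => (0:ℝ)) ∈ LipFuns d := ⟨0, LipschitzWith.const 0⟩
    exact ⟨⟨hl, fun ε hε => ⟨0, fun y _ => by simp [hε.le]⟩⟩,
      ⟨hl, fun ε hε => ⟨0, fun y _ => by simp [hε.le]⟩⟩⟩
  -- constants
  obtain ⟨R, hR⟩ := hcoer (μ + 2)
  set C : ℝ≥0 := ⟨|R| + ‖p‖, by positivity⟩ with hC
  have hCv : (C : ℝ) = |R| + ‖p‖ := rfl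
  obtain ⟨B, hB⟩ := hreg_bdd (C + ‖p‖ + 1) (by positivity)
  have hm : ∀ n : ℕ, (0:ℝ) < (n:ℝ) + 1 := fun n => by positivity
  have hB0 : ∀ ω : Ω, 0 ≤ B := fun ω => (abs_nonneg _).trans (hB ω 0 0 (by simp; positivity))
  choose δ hδ0 hδ using fun n : ℕ => hreg_uc (C + ‖p‖ + 1) (by positivity) (1 / ((n:ℝ) + 1))
    (by positivity)
  set M : ℕ → ℝ := fun n => 4 * B / δ n with hM
  set h : Ed d → Ed d → Ω → ℝ := fun q a ω => H (p + q) a ω with hh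
  have hcont : ∀ ω, Continuous fun q : Ed d × Ed d => h q.1 q.2 ω := fun ω =>
    (hHcont ω).comp ((continuous_const.add continuous_fst).prodMk continuous_snd)
  have hmeas : ∀ q a, Measurable (h q a) := fun q a =>
    hHmeas.comp (measurable_const.prodMk (measurable_const.prodMk measurable_id))
  set c : ℕ → Ed d → Ed d → Ω → ℝ := fun n a b ω =>
    cost (fun q x => h q x ω) μ ((n:ℝ) + 1) (M n) C a b with hc
  have hcost : ∀ n, IsCost τ C (c n) := fun n =>
    cost_isCost (hm n).le hmeas hcont fun q a z ω => hHstat (p + q) a z ω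
  have hcoer' : ∀ (n : ℕ) (ω : Ω) (q z : Ed d), h q z ω ≤ μ + 1 / ((n:ℝ) + 1) → ‖q‖ ≤ C := by
    intro n ω q z hq
    by_contra hcon
    have h1 : R ≤ ‖p + q‖ := by
      have : ‖q‖ ≤ ‖p + q‖ + ‖p‖ := by
        calc ‖q‖ = ‖(p + q) - p‖ := by congr 1; abel
          _ ≤ _ := norm_sub_le _ _
      rw [hCv] at hcon
      linarith [le_abs_self R, not_le.1 hcon]
    have h2 := hR ω _ z h1
    have h3 : 1 / ((n:ℝ) + 1) ≤ 1 := by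
      rw [div_le_one (hm n)]
      linarith [Nat.cast_nonneg (α := ℝ) n]
    simp only [hh] at hq
    linarith
  have hmod : ∀ (n : ℕ) (ω : Ω) (q z a v : Ed d), ‖q‖ ≤ C → ‖z - a‖ < 2 * ‖v‖ →
      h q a ω ≤ h q z ω + 1 / ((n:ℝ) + 1) + M n * ‖v‖ := by
    intro n ω q z a v hq hza
    have hpq : ‖p + q‖ ≤ C + ‖p‖ + 1 := by linarith [norm_add_le p q]
    have hMn : 0 ≤ M n := div_nonneg (by linarith [hB0 ω]) (hδ0 n).le
    have hMv : 0 ≤ M n * ‖v‖ := by positivity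
    have hn1 : 0 < 1 / ((n:ℝ) + 1) := by positivity
    by_cases hlt : ‖a - z‖ < δ n
    · have := hδ n ω (p + q) (p + q) a z hpq hpq (by simpa using hδ0 n) hlt
      have := (abs_lt.1 this).2
      simp only [hh]
      linarith
    · have h1 := (abs_le.1 (hB ω (p + q) a hpq)).2
      have h2 := (abs_le.1 (hB ω (p + q) z hpq)).1
      have h3 : δ n ≤ 2 * ‖v‖ := by
        rw [norm_sub_rev] at hza
        linarith [not_lt.1 hlt]
      have h4 : 2 * B ≤ M n * ‖v‖ := by
        simp only [hM]
        rw [div_mul_eq_mul_div, le_div_iff₀ (hδ0 n)]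
        nlinarith [hB0 ω]
      simp only [hh]
      linarith
  -- existence of subsolutions for the approximate levels
  have hsub : ∀ n, HasSub P (minCost c n) := by
    intro n
    filter_upwards [hHbarP p] with ω hω
    have hlt : HbarPlusOm d H p ω < μ + 1 / ((n:ℝ) + 1) := by
      rw [hω]
      have : 0 < 1 / ((n:ℝ) + 1) := by positivity
      linarith
    unfold HbarPlusOm at hlt
    obtain ⟨t, ⟨u, hu, rfl⟩, ht⟩ := exists_lt_of_csInf_lt (by exact ⟨_, _, hzero.1, rfl⟩) hlt
    obtain ⟨Bu, hBu⟩ := hbd u hu.1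
    have hae := le_essSup_of_bdd (hBu ω)
    obtain ⟨K, hK⟩ := hu.1
    refine ⟨u, hu, fun a b => le_minCost fun j hj => ?_⟩
    refine sub_cost hK C.coe_nonneg (hcont ω) ?_ (hcoer' j ω) (hmod j ω) a b
    filter_upwards [hae] with z hz
    refine hz.trans (ht.le.trans ?_)
    have : 1 / ((n:ℝ) + 1) ≤ 1 / ((j:ℝ) + 1) :=
      one_div_le_one_div_of_le (hm j) (by
        have : (j:ℝ) ≤ n := by exact_mod_cast hj
        linarith)
    linarith
  choose w hw1 hw2 hw3 using fun n => exists_mean_zero P hτmp hτgrp hτzero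
    (minCost_isCost hcost n) (hsub n)
  obtain ⟨W, hW1, hW2, hW3, hW4⟩ := limit_lemma P hτgrp hτzero (C := C) (w := w)
    (fun k => (hw1 k).toPreProc) (fun x z ε hε => ⟨0, fun k _ ω => by
      rw [(hw1 k).stat, sub_self, abs_zero]; exact hε.le⟩)
  have hWpre : PreProc C W := hW1.toPreProc
  have hWc : ∀ n, SubC P (c n) W := by
    intro n
    refine hW2 (c n) ?_
    filter_upwards [eventually_ge_atTop n] with k hk
    filter_upwards [hw2 k] with ω hω a b
    exact (hω a b).trans (minCost_le hk a b ω)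
  have hW0 : ∀ x, ∫ ω, W x ω ∂P = 0 := fun x => le_antisymm
    (hW3 x 0 (Eventually.of_forall fun k => (hw3 k x).le))
    (hW4 x 0 (Eventually.of_forall fun k => (hw3 k x).ge))
  have hbound := sublinear_bound P hτmp hτgrp hτzero hτerg hW1 hW0
  have hgradW : ∀ᵐ ω ∂P, ∀ᵐ y ∂(volume : Measure (Ed d)),
      H (p + gradient (fun y' => W y' ω) y) y ω ≤ μ := by
    filter_upwards [ae_all_iff.2 hWc] with ω hω
    filter_upwards [(hWpre.lip ω).ae_differentiableAt (μ := volume)] with y hy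
    refine cost_grad (h := fun q x => h q x ω) (M := M) hd C.coe_nonneg (hcont ω) ?_ hy
      fun n b => hω n y b
    intro x x' a
    have := hqc ω (p + x) (p + x') a
    simp only [hh]
    have e : p + (1 / 2 : ℝ) • (x + x') = (1 / 2 : ℝ) • (p + x + (p + x')) := by module
    rw [e]
    exact this
  refine ⟨?_, W, ?_, ⟨C, hWpre.lip⟩, ?_, ?_, ?_⟩
  · filter_upwards [hHbarP p, hgradW, hbound] with ω h1 h2 h3
    have hWS : (fun y => W y ω) ∈ Scal d := scal_of_bound (hWpre.lip ω) h3
    apply le_antisymm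
    · unfold HhatOm
      refine (csInf_le ⟨M0, ?_⟩ (by exact ⟨_, hWS, rfl⟩)).trans ?_
      · rintro _ ⟨u, hu, rfl⟩
        exact hlow u hu.1.1 ω
      · obtain ⟨B', hB'⟩ := hbd _ hWS.1.1
        exact essSup_le_of_bdd (hB' ω) h2
    · rw [hμ, ← h1]
      unfold HhatOm HbarPlusOm
      refine csInf_le_csInf ⟨M0, ?_⟩ (by exact ⟨_, _, hzero, rfl⟩) ?_
      · rintro _ ⟨u, hu, rfl⟩
        exact hlow u hu.1 ω
      · rintro _ ⟨u, hu, rfl⟩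
        exact ⟨u, hu.1, rfl⟩
  · exact measurable_uncurry_of_continuous_of_measurable (u := W)
      (fun ω => (hWpre.lip ω).continuous) hWpre.meas
  · intro x y z ω
    rw [hW1.stat, hW1.stat]; ring
  · intro x
    simp only [hWpre.zero, sub_zero]
    exact hW0 x
  · filter_upwards [hgradW, hbound] with ω h2 h3
    exact ⟨h2, tendsto_of_bound h3⟩
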